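/- arXiv:2407.16416 — 4 statements merged into one kernel-verified Lean document; each statement's English description precedes it below -/
import Mathlib

section
/- Let X ⊂ ℝ^d be a relatively separated set and s > d. Then there exists a constant C > 0 such that every B(H)-valued matrix A = [A_{k,l}]_{k,l∈X} with finite Jaffard norm ‖A‖_{J_s} = sup_{k,l∈X} ‖A_{k,l}‖ (1+|k−l|)^s defines (via (Ag)_k = Σ_{l∈X} A_{k,l} g_l, with the series converging absolutely in H for every k) a bounded linear operator on ℓ²(X;H) satisfying ‖A‖_{B(ℓ²(X;H))} ≤ C ‖A‖_{J_s}. -/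
open scoped ENNReal
open Set

noncomputable section

/-- `ℝ^d` with the Euclidean norm. -/
abbrev Euc (d : ℕ) := EuclideanSpace ℝ (Fin d)

/-- A set `X ⊂ ℝ^d` is relatively separated if
`sup_{x ∈ ℝ^d} #(X ∩ (x + [0,1]^d)) < ∞`. -/
def RelSep {d : ℕ} (X : Set (Euc d)) : Prop :=
  ∃ N : ℕ, ∀ x : Euc d,
    (X ∩ {y | ∀ j, x j ≤ y j ∧ y j ≤ x j + 1}).Finite ∧
    (X ∩ {y | ∀ j, x j ≤ y j ∧ y j ≤ x j + 1}).ncard ≤ N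

/-- The Jaffard norm `sup_{k,l ∈ X} ‖A_{k,l}‖ (1+|k-l|)^s`. -/
noncomputable def jaffardNorm {d : ℕ} {X : Set (Euc d)} {H : Type*}
    [NormedAddCommGroup H] [InnerProductSpace ℂ H]
    (s : ℝ) (A : ↥X → ↥X → (H →L[ℂ] H)) : ℝ :=
  ⨆ q : ↥X × ↥X, ‖A q.1 q.2‖ * (1 + ‖(q.1 : Euc d) - (q.2 : Euc d)‖) ^ s

open MeasureTheory

/-- The closed unit cube with lower corner `x`. -/
def unitCube {d : ℕ} (x : Euc d) : Set (Euc d) :=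
  {y | ∀ j, x j ≤ y j ∧ y j ≤ x j + 1}

lemma unitCube_eq_preimage {d : ℕ} (x : Euc d) :
    unitCube x = (WithLp.ofLp : Euc d → Fin d → ℝ) ⁻¹' Icc x.ofLp (fun j => x j + 1) := by
  ext y
  simp [unitCube, Pi.le_def, forall_and]

lemma measurableSet_unitCube {d : ℕ} (x : Euc d) : MeasurableSet (unitCube x) := by
  rw [unitCube_eq_preimage]
  exact (PiLp.volume_preserving_ofLp (Fin d)).measurable measurableSet_Icc

lemma volume_unitCube {d : ℕ} (x : Euc d) : volume (unitCube x) = 1 := by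
  rw [unitCube_eq_preimage, (PiLp.volume_preserving_ofLp (Fin d)).measure_preimage
    measurableSet_Icc.nullMeasurableSet, Real.volume_Icc_pi]
  simp

lemma norm_sub_le_of_mem_unitCube {d : ℕ} {x y : Euc d} (h : y ∈ unitCube x) :
    ‖x - y‖ ≤ √d := by
  rw [EuclideanSpace.norm_eq]
  apply Real.sqrt_le_sqrt
  calc ∑ j, ‖(x - y) j‖ ^ 2 ≤ ∑ _j : Fin d, (1 : ℝ) := by
        refine Finset.sum_le_sum fun j _ => ?_
        have := h j
        rw [Real.norm_eq_abs, sq_abs, PiLp.sub_apply]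
        nlinarith
    _ = d := by simp

/-- Polynomial weights vary by at most a constant factor over a unit cube. -/
lemma weight_le_of_mem_unitCube {d : ℕ} {s : ℝ} (hs : 0 ≤ s) {k l x : Euc d}
    (h : x ∈ unitCube l) :
    (1 + ‖k - l‖) ^ (-s) ≤ (1 + √d) ^ s * (1 + ‖x - k‖) ^ (-s) := by
  have h1 : ‖x - k‖ ≤ ‖k - l‖ + √d := by
    have := norm_sub_le_of_mem_unitCube h
    have h2 := norm_sub_le_norm_sub_add_norm_sub k l x
    rw [norm_sub_rev x k]
    linarith
  have h2 : 1 + ‖x - k‖ ≤ (1 + √d) * (1 + ‖k - l‖) := by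
    nlinarith [Real.sqrt_nonneg (d : ℝ), norm_nonneg (k - l)]
  have h3 : (1 + ‖x - k‖) ^ s ≤ (1 + √d) ^ s * (1 + ‖k - l‖) ^ s := by
    rw [← Real.mul_rpow (by positivity) (by positivity)]
    exact Real.rpow_le_rpow (by positivity) h2 hs
  rw [Real.rpow_neg (by positivity), Real.rpow_neg (by positivity), ← div_eq_mul_inv,
    le_div_iff₀ (by positivity), inv_mul_le_iff₀ (by positivity), mul_comm]
  exact h3

/-- A relatively separated set has boundedly many points whose unit cube covers a given point. -/
lemma RelSep.exists_card_unitCube_le {d : ℕ} {X : Set (Euc d)} (hX : RelSep X) :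
    ∃ N : ℕ, ∀ (S : Finset X) (x : Euc d),
      ∑ l ∈ S, (unitCube (l : Euc d)).indicator (fun _ => (1 : ℝ≥0∞)) x ≤ N := by
  classical
  obtain ⟨N, hN⟩ := hX
  refine ⟨N, fun S x => ?_⟩
  obtain ⟨hfin, hcard⟩ := hN (WithLp.toLp 2 fun j => x j - 1)
  have hsum : ∑ l ∈ S, (unitCube (l : Euc d)).indicator (fun _ => (1 : ℝ≥0∞)) x
      = ((S.filter fun l : X => x ∈ unitCube (l : Euc d)).card : ℝ≥0∞) := by
    simp [Set.indicator_apply, Finset.sum_boole]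
  rw [hsum, Nat.cast_le]
  refine le_trans ?_ hcard
  rw [← Finset.card_map (Function.Embedding.subtype _), ← Set.ncard_coe_finset]
  refine Set.ncard_le_ncard ?_ hfin
  intro y hy
  simp only [Finset.coe_map, Set.mem_image, Finset.mem_coe, Finset.mem_filter] at hy
  obtain ⟨l, ⟨-, hl⟩, rfl⟩ := hy
  refine ⟨l.2, fun j => ?_⟩
  have := hl j
  simp only [Function.Embedding.subtype_apply]
  constructor <;> linarith

/-- Polynomial weights of order larger than the dimension are uniformly summable over a
relatively separated set. -/
lemma RelSep.exists_sum_weight_le {d : ℕ} {X : Set (Euc d)} (hX : RelSep X) {s : ℝ}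
    (hs : (d : ℝ) < s) :
    ∃ K : ℝ, 0 < K ∧ ∀ (k : Euc d) (S : Finset X),
      ∑ l ∈ S, (1 + ‖k - (l : Euc d)‖) ^ (-s) ≤ K := by
  obtain ⟨N, hN⟩ := hX.exists_card_unitCube_le
  have hs0 : 0 ≤ s := (Nat.cast_nonneg d).trans hs.le
  set I : ℝ≥0∞ := ∫⁻ x : Euc d, ENNReal.ofReal ((1 + ‖x‖) ^ (-s))
  have hIfin : I < ∞ := finite_integral_one_add_norm (by simpa using hs)
  set c : ℝ≥0∞ := ENNReal.ofReal ((1 + √d) ^ s) with hc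
  have hfin : (N : ℝ≥0∞) * (c * I) ≠ ∞ :=
    ENNReal.mul_ne_top (by simp) (ENNReal.mul_ne_top ENNReal.ofReal_ne_top hIfin.ne)
  refine ⟨((N : ℝ≥0∞) * (c * I)).toReal + 1, by positivity, fun k S => ?_⟩
  refine le_trans ?_ (le_add_of_nonneg_right zero_le_one)
  rw [← ENNReal.ofReal_le_iff_le_toReal hfin,
    ENNReal.ofReal_sum_of_nonneg fun l _ => by positivity]
  set g : Euc d → ℝ≥0∞ := fun x => c * ENNReal.ofReal ((1 + ‖x - k‖) ^ (-s)) with hg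
  have hgm : Measurable g := by fun_prop
  calc ∑ l ∈ S, ENNReal.ofReal ((1 + ‖k - (l : Euc d)‖) ^ (-s))
      ≤ ∑ l ∈ S, ∫⁻ x, (unitCube (l : Euc d)).indicator (fun _ => 1) x * g x := by
        refine Finset.sum_le_sum fun l _ => ?_
        calc ENNReal.ofReal ((1 + ‖k - (l : Euc d)‖) ^ (-s))
            = ∫⁻ x, (unitCube (l : Euc d)).indicator
                (fun _ => ENNReal.ofReal ((1 + ‖k - (l : Euc d)‖) ^ (-s))) x := by
              rw [lintegral_indicator_const (measurableSet_unitCube _), volume_unitCube, mul_one]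
          _ ≤ _ := by
              refine lintegral_mono fun x => ?_
              by_cases hx : x ∈ unitCube (l : Euc d)
              · simp only [Set.indicator_of_mem hx, one_mul, hg, hc]
                rw [← ENNReal.ofReal_mul (by positivity)]
                exact ENNReal.ofReal_le_ofReal (weight_le_of_mem_unitCube hs0 hx)
              · simp [Set.indicator_of_notMem hx]
    _ = ∫⁻ x, ∑ l ∈ S, (unitCube (l : Euc d)).indicator (fun _ => 1) x * g x := by
        rw [lintegral_finsetSum]
        exact fun l _ => (measurable_one.indicator (measurableSet_unitCube _)).mul hgm
    _ ≤ ∫⁻ x, N * g x := by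
        refine lintegral_mono fun x => ?_
        simp only [← Finset.sum_mul]
        exact mul_le_mul_left (hN S x) _
    _ = N * (c * I) := by
        rw [lintegral_const_mul _ hgm, lintegral_const_mul _ (by fun_prop),
          lintegral_sub_right_eq_self (fun x : Euc d => ENNReal.ofReal ((1 + ‖x‖) ^ (-s))) k]

/-- Schur's test on `ℓ²`, for a nonnegative kernel with bounded row and column sums. -/
lemma schur_test {ι : Type*} {w : ι → ι → ℝ} (hw : ∀ k l, 0 ≤ w k l) {K : ℝ} (hK : 0 ≤ K)
    (hrow : ∀ k (S : Finset ι), ∑ l ∈ S, w k l ≤ K)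
    (hcol : ∀ l (S : Finset ι), ∑ k ∈ S, w k l ≤ K)
    {b : ι → ℝ} (hb : ∀ l, 0 ≤ b l) {B : ℝ} (hB : ∀ S : Finset ι, ∑ l ∈ S, b l ^ 2 ≤ B) :
    (∀ k, Summable fun l => w k l * b l) ∧
      ∀ T : Finset ι, ∑ k ∈ T, (∑' l, w k l * b l) ^ 2 ≤ K ^ 2 * B := by
  have hb2 : Summable fun l => b l ^ 2 := summable_of_sum_le (fun l => sq_nonneg _) hB
  have hwK : ∀ k l, w k l ≤ K := fun k l => by simpa using hrow k {l}
  have hwb2 : ∀ k, Summable fun l => w k l * b l ^ 2 := fun k =>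
    (hb2.mul_left K).of_nonneg_of_le (fun l => mul_nonneg (hw k l) (sq_nonneg _))
      fun l => mul_le_mul_of_nonneg_right (hwK k l) (sq_nonneg _)
  have hwsum : ∀ k, Summable (w k) := fun k => summable_of_sum_le (hw k) (hrow k)
  have hwb : ∀ k, Summable fun l => w k l * b l := fun k =>
    ((hwsum k).add (hwb2 k)).of_nonneg_of_le (fun l => mul_nonneg (hw k l) (hb l)) fun l => by
      nlinarith [mul_nonneg (hw k l) (sq_nonneg (b l - 1)), mul_nonneg (hw k l) (sq_nonneg (b l)),
        hw k l]
  refine ⟨hwb, fun T => ?_⟩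
  have hcs : ∀ k, (∑' l, w k l * b l) ^ 2 ≤ K * ∑' l, w k l * b l ^ 2 := fun k => by
    refine le_of_tendsto ((hwb k).hasSum.pow 2) (Filter.Eventually.of_forall fun S => ?_)
    calc (∑ l ∈ S, w k l * b l) ^ 2 ≤ (∑ l ∈ S, w k l) * ∑ l ∈ S, w k l * b l ^ 2 :=
          Finset.sum_sq_le_sum_mul_sum_of_sq_le_mul S (fun l _ => hw k l)
            (fun l _ => mul_nonneg (hw k l) (sq_nonneg _)) fun l _ => by apply le_of_eq; ring
      _ ≤ K * ∑' l, w k l * b l ^ 2 :=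
          mul_le_mul (hrow k S)
            ((hwb2 k).sum_le_tsum S fun l _ => mul_nonneg (hw k l) (sq_nonneg _))
            (Finset.sum_nonneg fun l _ => mul_nonneg (hw k l) (sq_nonneg _)) hK
  calc ∑ k ∈ T, (∑' l, w k l * b l) ^ 2 ≤ ∑ k ∈ T, K * ∑' l, w k l * b l ^ 2 :=
        Finset.sum_le_sum fun k _ => hcs k
    _ = K * ∑' l, ∑ k ∈ T, w k l * b l ^ 2 := by
        rw [← Finset.mul_sum, Summable.tsum_finsetSum fun k _ => hwb2 k]
    _ ≤ K * ∑' l, K * b l ^ 2 := by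
        refine mul_le_mul_of_nonneg_left ?_ hK
        refine (summable_sum fun k _ => hwb2 k).tsum_le_tsum (fun l => ?_) (hb2.mul_left K)
        rw [← Finset.sum_mul]
        exact mul_le_mul_of_nonneg_right (hcol l T) (sq_nonneg _)
    _ = K ^ 2 * ∑' l, b l ^ 2 := by rw [tsum_mul_left]; ring
    _ ≤ K ^ 2 * B := by
        refine mul_le_mul_of_nonneg_left (hb2.tsum_le_of_sum_le hB) (sq_nonneg _)

/-- The entries of a matrix decay at the rate prescribed by its Jaffard norm. -/
lemma norm_le_jaffardNorm_mul {d : ℕ} {X : Set (Euc d)} {H : Type*}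
    [NormedAddCommGroup H] [InnerProductSpace ℂ H] {s : ℝ} {A : X → X → (H →L[ℂ] H)}
    (hA : BddAbove (Set.range fun q : X × X =>
      ‖A q.1 q.2‖ * (1 + ‖(q.1 : Euc d) - (q.2 : Euc d)‖) ^ s)) (k l : X) :
    ‖A k l‖ ≤ jaffardNorm s A * (1 + ‖(k : Euc d) - (l : Euc d)‖) ^ (-s) := by
  rw [Real.rpow_neg (by positivity), ← div_eq_mul_inv, le_div_iff₀ (by positivity)]
  exact le_ciSup hA (k, l)

lemma jaffardNorm_nonneg {d : ℕ} {X : Set (Euc d)} {H : Type*}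
    [NormedAddCommGroup H] [InnerProductSpace ℂ H] (s : ℝ) (A : X → X → (H →L[ℂ] H)) :
    0 ≤ jaffardNorm s A :=
  Real.iSup_nonneg fun _ => by positivity

theorem statement1 {d : ℕ} (X : Set (Euc d)) (hX : RelSep X)
    (H : Type*) [NormedAddCommGroup H] [InnerProductSpace ℂ H] [CompleteSpace H]
    [TopologicalSpace.SeparableSpace H]
    (s : ℝ) (hs : (d : ℝ) < s) :
    ∃ C > 0, ∀ A : ↥X → ↥X → (H →L[ℂ] H),
      BddAbove (Set.range fun q : ↥X × ↥X =>
        ‖A q.1 q.2‖ * (1 + ‖(q.1 : Euc d) - (q.2 : Euc d)‖) ^ s) →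
      ∀ f : lp (fun _ : ↥X => H) 2,
        (∀ k : ↥X, Summable fun l : ↥X => ‖A k l (f l)‖) ∧
        ∃ hAf : Memℓp (fun k : ↥X => ∑' l : ↥X, A k l (f l)) 2,
          ‖(⟨_, hAf⟩ : lp (fun _ : ↥X => H) 2)‖ ≤ C * jaffardNorm s A * ‖f‖ := by
  obtain ⟨K, hK, hsum⟩ := hX.exists_sum_weight_le hs
  refine ⟨K, hK, fun A hA f => ?_⟩
  have hM := jaffardNorm_nonneg s A
  set M := jaffardNorm s A
  have h2 : (0 : ℝ) < (2 : ℝ≥0∞).toReal := by norm_num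
  obtain ⟨hwb, hschur⟩ := schur_test
    (w := fun k l : X => (1 + ‖(k : Euc d) - (l : Euc d)‖) ^ (-s)) (fun k l => by positivity)
    hK.le (fun k S => hsum k S)
    (fun l S => by simpa only [norm_sub_rev] using hsum (l : Euc d) S)
    (b := fun l => ‖f l‖) (fun l => norm_nonneg _) (B := ‖f‖ ^ 2)
    (fun S => by simpa using lp.sum_rpow_le_norm_rpow h2 f S)
  have hentry : ∀ k l : X, ‖A k l (f l)‖
      ≤ M * ((1 + ‖(k : Euc d) - (l : Euc d)‖) ^ (-s) * ‖f l‖) := fun k l => by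
    rw [← mul_assoc]
    exact (A k l).le_of_opNorm_le (norm_le_jaffardNorm_mul hA k l) (f l)
  have habs : ∀ k : X, Summable fun l : X => ‖A k l (f l)‖ := fun k =>
    ((hwb k).mul_left M).of_nonneg_of_le (fun l => norm_nonneg _) (hentry k)
  have hbound : ∀ T : Finset X,
      ∑ k ∈ T, ‖∑' l : X, A k l (f l)‖ ^ (2 : ℝ≥0∞).toReal
        ≤ (K * M * ‖f‖) ^ (2 : ℝ≥0∞).toReal := fun T => by
    simp only [ENNReal.toReal_ofNat, Real.rpow_ofNat]
    calc ∑ k ∈ T, ‖∑' l : X, A k l (f l)‖ ^ 2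
        ≤ ∑ k ∈ T, M ^ 2 *
            (∑' l : X, (1 + ‖(k : Euc d) - (l : Euc d)‖) ^ (-s) * ‖f l‖) ^ 2 := by
          refine Finset.sum_le_sum fun k _ => ?_
          rw [← mul_pow, ← tsum_mul_left]
          refine pow_le_pow_left₀ (norm_nonneg _) ?_ 2
          exact (norm_tsum_le_tsum_norm (habs k)).trans
            ((habs k).tsum_le_tsum (hentry k) ((hwb k).mul_left M))
      _ ≤ M ^ 2 * (K ^ 2 * ‖f‖ ^ 2) := by
          rw [← Finset.mul_sum]
          exact mul_le_mul_of_nonneg_left (hschur T) (sq_nonneg _)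
      _ = (K * M * ‖f‖) ^ 2 := by ring
  exact ⟨habs, memℓp_gen' hbound,
    lp.norm_le_of_forall_sum_le h2 (by positivity) hbound⟩
end
end

section
/- Let X ⊂ ℝ^d be a relatively separated set, s > d, and γ = 1 − d/s > 0. Then there exists a constant C > 0 such that for every B(H)-valued matrix A = [A_{k,l}]_{k,l∈X} with finite Jaffard norm ‖A‖_{J_s} = sup_{k,l∈X} ‖A_{k,l}‖ (1+|k−l|)^s, the square A² (with entries [A²]_{k,l} = Σ_{n∈X} A_{k,n} A_{n,l}) satisfies ‖A²‖_{J_s} ≤ C ‖A‖_{J_s}^{2−γ} ‖A‖_{B(ℓ²(X;H))}^{γ}, where ‖A‖_{B(ℓ²(X;H))} is the operator norm of the bounded operator on ℓ²(X;H) defined by A. -/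
open scoped ENNReal
open Set

noncomputable section

theorem RelSep.exists_card_le {d : ℕ} {X : Set (Euc d)} (hX : RelSep X) :
    ∃ K : ℝ, 0 < K ∧ ∀ (k : Euc d) (ρ : ℝ), 1 ≤ ρ → ∀ F : Finset X,
      (∀ n ∈ F, ‖(n : Euc d) - k‖ ≤ ρ) → (F.card : ℝ) ≤ K * ρ ^ d := by
  classical
  obtain ⟨N, hN⟩ := hX
  refine ⟨(N + 1) * 5 ^ d, by positivity, fun k ρ hρ F hF => ?_⟩
  let cell : X → Fin d → ℤ := fun n j => ⌊(n : Euc d) j - k j⌋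
  let S : Finset (Fin d → ℤ) := Fintype.piFinset fun _ => Finset.Icc (-⌈ρ⌉) ⌈ρ⌉
  have hmaps : ∀ n ∈ F, cell n ∈ S := by
    intro n hn
    rw [Fintype.mem_piFinset]
    intro j
    have h1 : |(n : Euc d) j - k j| ≤ ρ := by
      have := PiLp.norm_apply_le ((n : Euc d) - k) j
      simpa using this.trans (hF n hn)
    rw [abs_le] at h1
    have h2 := Int.le_ceil ρ
    rw [Finset.mem_Icc]
    constructor
    · rw [Int.le_floor]; push_cast; linarith
    · have : (⌊(n : Euc d) j - k j⌋ : ℝ) ≤ ⌈ρ⌉ := (Int.floor_le _).trans (h1.2.trans h2)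
      exact_mod_cast this
  have hfib : ∀ z ∈ S, (F.filter fun n => cell n = z).card ≤ N := by
    intro z _
    let x : Euc d := WithLp.toLp 2 fun j => k j + z j
    obtain ⟨hfin, hcard⟩ := hN x
    refine le_trans ?_ hcard
    rw [← Finset.card_image_of_injective _ Subtype.val_injective, ← Set.ncard_coe_finset]
    refine Set.ncard_le_ncard ?_ hfin
    intro y hy
    simp only [Finset.coe_image, Set.mem_image, Finset.mem_coe, Finset.mem_filter] at hy
    obtain ⟨n, ⟨-, hn⟩, rfl⟩ := hy
    refine ⟨n.2, fun j => ?_⟩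
    have hj : ⌊(n : Euc d) j - k j⌋ = z j := congrFun hn j
    rw [Int.floor_eq_iff] at hj
    change k j + z j ≤ (n : Euc d) j ∧ (n : Euc d) j ≤ k j + z j + 1
    constructor <;> linarith [hj.1, hj.2]
  have hcard : F.card ≤ N * S.card :=
    Finset.card_le_mul_card_image_of_maps_to hmaps N hfib
  have hS : (S.card : ℝ) ≤ (5 * ρ) ^ d := by
    have hc : 0 ≤ ⌈ρ⌉ := Int.ceil_nonneg (by linarith)
    have h1 : ((Finset.Icc (-⌈ρ⌉) ⌈ρ⌉).card : ℝ) ≤ 5 * ρ := by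
      have h : (((Finset.Icc (-⌈ρ⌉) ⌈ρ⌉).card : ℤ) : ℝ) = ((⌈ρ⌉ + 1 - -⌈ρ⌉ : ℤ) : ℝ) := by
        rw [Int.card_Icc, Int.toNat_of_nonneg (by omega)]
      push_cast at h
      rw [h]
      linarith [Int.ceil_lt_add_one ρ]
    simp only [S, Fintype.card_piFinset, Finset.prod_const, Finset.card_univ, Fintype.card_fin]
    push_cast
    exact pow_le_pow_left₀ (by positivity) h1 d
  calc (F.card : ℝ) ≤ N * S.card := by exact_mod_cast hcard
    _ ≤ (N + 1) * (5 * ρ) ^ d := by gcongr; linarith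
    _ = (N + 1) * 5 ^ d * ρ ^ d := by rw [mul_pow]; ring

/-- A dyadic upper bound for a truncated power. -/
theorem exists_nat_le_rpow_two {s x v : ℝ} (hs : 0 < s) (hx : 0 < x) (hv : v ≤ 1)
    (hvx : v * x ^ s ≤ 1) : ∃ j : ℕ, x ≤ 2 ^ (j + 1) ∧ v ≤ (2 ^ (-s) : ℝ) ^ j := by
  by_cases h : x ≤ 1
  · exact ⟨0, by norm_num; linarith, by simpa using hv⟩
  · push Not at h
    obtain ⟨j, hj1, hj2⟩ := exists_nat_pow_near h.le (one_lt_two : (1 : ℝ) < 2)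
    refine ⟨j, hj2.le, ?_⟩
    have h1 : v ≤ (x ^ s)⁻¹ := by
      rw [← one_div, le_div_iff₀ (by positivity)]; exact hvx
    refine h1.trans ?_
    have h2 : (2 ^ (-s) : ℝ) ^ j = (((2 : ℝ) ^ j) ^ s)⁻¹ := by
      rw [Real.rpow_neg (by norm_num), inv_pow, Real.rpow_pow_comm (by norm_num)]
    rw [h2]
    gcongr

theorem RelSep.exists_sum_le {d : ℕ} {X : Set (Euc d)} (hX : RelSep X) {s : ℝ}
    (hs : (d : ℝ) < s) :
    ∃ K : ℝ, 0 < K ∧ ∀ (k : Euc d) (R : ℝ), 1 ≤ R → ∀ v : X → ℝ, (∀ n, v n ≤ 1) →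
      (∀ n, v n * (1 + ‖(n : Euc d) - k‖) ^ s ≤ R ^ s) →
      ∀ F : Finset X, ∑ n ∈ F, v n ≤ K * R ^ d := by
  classical
  obtain ⟨K, hK, hcard⟩ := hX.exists_card_le
  have hs0 : 0 < s := lt_of_le_of_lt (Nat.cast_nonneg d) hs
  set q : ℝ := 2 ^ (-s) with hq
  have hq0 : 0 < q := by positivity
  set r : ℝ := q * 2 ^ d with hr
  have hr0 : 0 < r := by positivity
  have hr1 : r < 1 := by
    rw [hr, hq, ← Real.rpow_natCast, ← Real.rpow_add (by norm_num)]
    exact Real.rpow_lt_one_of_one_lt_of_neg (by norm_num) (by linarith)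
  refine ⟨K * 2 ^ d * (1 - r)⁻¹, by have : 0 < 1 - r := by linarith
                                    positivity, ?_⟩
  intro k R hR v hv1 hvR F
  have hR0 : 0 < R := by linarith
  have hex : ∀ n : X, ∃ j : ℕ, (1 + ‖(n : Euc d) - k‖) / R ≤ 2 ^ (j + 1) ∧ v n ≤ q ^ j := by
    intro n
    refine exists_nat_le_rpow_two hs0 (by positivity) (hv1 n) ?_
    rw [Real.div_rpow (by positivity) hR0.le, ← mul_div_assoc, div_le_one (by positivity)]
    exact hvR n
  choose j hj1 hj2 using hex
  calc ∑ n ∈ F, v n ≤ ∑ n ∈ F, q ^ j n := Finset.sum_le_sum fun n _ => hj2 n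
    _ = ∑ i ∈ F.image j, ∑ n ∈ F.filter (fun n => j n = i), q ^ j n :=
        (Finset.sum_fiberwise_of_maps_to (fun n hn => Finset.mem_image_of_mem j hn) _).symm
    _ ≤ ∑ i ∈ F.image j, K * 2 ^ d * R ^ d * r ^ i := by
        refine Finset.sum_le_sum fun i _ => ?_
        have h1 : ∑ n ∈ F.filter (fun n => j n = i), q ^ j n
            = (F.filter (fun n => j n = i)).card * q ^ i := by
          rw [Finset.sum_congr rfl (g := fun _ => q ^ i)
            (fun n hn => by rw [(Finset.mem_filter.1 hn).2]), Finset.sum_const, nsmul_eq_mul]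
        have h2 := hcard k (R * 2 ^ (i + 1))
          (one_le_mul_of_one_le_of_one_le hR (one_le_pow₀ (by norm_num)))
          (F.filter (fun n => j n = i)) (by
            intro n hn
            have := hj1 n
            rw [(Finset.mem_filter.1 hn).2, div_le_iff₀ hR0] at this
            linarith)
        rw [h1]
        calc _ ≤ K * (R * 2 ^ (i + 1)) ^ d * q ^ i := by gcongr
          _ = _ := by rw [hr]; ring
    _ = K * 2 ^ d * R ^ d * ∑ i ∈ F.image j, r ^ i := by rw [Finset.mul_sum]
    _ ≤ K * 2 ^ d * R ^ d * (1 - r)⁻¹ := by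
        gcongr
        rw [← tsum_geometric_of_lt_one hr0.le hr1]
        exact (summable_geometric_of_lt_one hr0.le hr1).sum_le_tsum _ fun i _ => by positivity
    _ = _ := by ring

/-- Interpolation between a uniform bound `t` and polynomial decay with constant `J`. -/
theorem RelSep.exists_sum_le_rpow_mul_rpow {d : ℕ} {X : Set (Euc d)} (hX : RelSep X) {s : ℝ}
    (hs : (d : ℝ) < s) :
    ∃ K : ℝ, 0 < K ∧ ∀ (k : Euc d) (J t : ℝ) (v : X → ℝ), 0 ≤ J → 0 ≤ t → (∀ n, 0 ≤ v n) →
      (∀ n, v n ≤ t) → (∀ n, v n * (1 + ‖(n : Euc d) - k‖) ^ s ≤ J) →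
      ∀ F : Finset X, ∑ n ∈ F, v n ≤ K * (J ^ ((d : ℝ) / s) * t ^ (1 - (d : ℝ) / s)) := by
  obtain ⟨K, hK, hsum⟩ := hX.exists_sum_le hs
  have hs0 : 0 < s := lt_of_le_of_lt (Nat.cast_nonneg d) hs
  have hγ : 0 < 1 - (d : ℝ) / s := by rw [sub_pos, div_lt_one hs0]; exact hs
  refine ⟨K, hK, fun k J t v hJ ht hv0 hvt hvJ F => ?_⟩
  have hvm : ∀ n, v n ≤ min t J := fun n => le_min (hvt n) <|
    (le_mul_of_one_le_right (hv0 n)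
      (Real.one_le_rpow (by linarith [norm_nonneg ((n : Euc d) - k)]) hs0.le)).trans (hvJ n)
  rcases (le_min ht hJ).eq_or_lt with h0 | hm
  · have : ∑ n ∈ F, v n ≤ 0 := Finset.sum_nonpos fun n _ => (hvm n).trans h0.ge
    exact this.trans (by positivity)
  · set m := min t J
    have hmJ : m ≤ J := min_le_right _ _
    have hJ0 : 0 < J := hm.trans_le hmJ
    set R := (J / m) ^ (s⁻¹) with hR
    have hRs : R ^ s = J / m := Real.rpow_inv_rpow (by positivity) hs0.ne'
    have hR1 : 1 ≤ R := Real.one_le_rpow ((one_le_div hm).2 hmJ) (by positivity)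
    have h := hsum k R hR1 (fun n => v n / m) (fun n => (div_le_one hm).2 (hvm n))
      (fun n => by
        rw [hRs, div_mul_eq_mul_div]
        exact div_le_div_of_nonneg_right (hvJ n) hm.le) F
    rw [← Finset.sum_div, div_le_iff₀ hm] at h
    have hRd : R ^ d = J ^ ((d : ℝ) / s) / m ^ ((d : ℝ) / s) := by
      rw [hR, ← Real.rpow_natCast, ← Real.rpow_mul (by positivity), inv_mul_eq_div,
        Real.div_rpow hJ hm.le]
    calc ∑ n ∈ F, v n ≤ K * R ^ d * m := h
      _ = K * (J ^ ((d : ℝ) / s) * m ^ (1 - (d : ℝ) / s)) := by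
          rw [hRd, Real.rpow_sub hm, Real.rpow_one]; ring
      _ ≤ _ := by
          gcongr
          exact min_le_left _ _

theorem mul_mul_rpow_le {s J a b p q r : ℝ} (hs : 0 < s) (ha : 0 ≤ a) (hb : 0 ≤ b)
    (hp : 0 ≤ p) (hq : 0 ≤ q) (hr : 0 ≤ r) (hrpq : r ≤ p + q)
    (haJ : a * (1 + p) ^ s ≤ J) (hbJ : b * (1 + q) ^ s ≤ J) :
    a * b * (1 + r) ^ s ≤ 2 ^ s * J * (a + b) := by
  have hJ : 0 ≤ J := le_trans (by positivity) haJ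
  rcases le_total q p with h | h
  · calc a * b * (1 + r) ^ s ≤ a * b * (2 * (1 + p)) ^ s := by gcongr; linarith
      _ = 2 ^ s * (a * (1 + p) ^ s) * b := by
          rw [Real.mul_rpow (by norm_num) (by positivity)]; ring
      _ ≤ 2 ^ s * J * (a + b) := by gcongr; linarith
  · calc a * b * (1 + r) ^ s ≤ a * b * (2 * (1 + q)) ^ s := by gcongr; linarith
      _ = 2 ^ s * (b * (1 + q) ^ s) * a := by
          rw [Real.mul_rpow (by norm_num) (by positivity)]; ring
      _ ≤ 2 ^ s * J * (a + b) := by gcongr; linarith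

theorem norm_entry_le_opNorm {ι H : Type*} [NormedAddCommGroup H] [InnerProductSpace ℂ H]
    (A : ι → ι → (H →L[ℂ] H)) (T : lp (fun _ : ι => H) 2 →L[ℂ] lp (fun _ : ι => H) 2)
    (hT : ∀ (f : lp (fun _ : ι => H) 2) (k : ι), T f k = ∑' l : ι, A k l (f l)) (k l : ι) :
    ‖A k l‖ ≤ ‖T‖ := by
  classical
  refine ContinuousLinearMap.opNorm_le_bound _ T.opNorm_nonneg fun x => ?_
  have h : T (lp.single 2 l x) k = A k l x := by
    rw [hT, tsum_eq_single l]
    · simp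
    · intro n hn
      simp [hn]
  rw [← h]
  calc _ ≤ ‖T (lp.single 2 l x)‖ := lp.norm_apply_le_norm (by norm_num) _ k
    _ ≤ ‖T‖ * ‖lp.single (E := fun _ : ι => H) 2 l x‖ := T.le_opNorm _
    _ = ‖T‖ * ‖x‖ := by rw [lp.norm_single (by norm_num)]

theorem statement5 {d : ℕ} (X : Set (Euc d)) (hX : RelSep X)
    (H : Type*) [NormedAddCommGroup H] [InnerProductSpace ℂ H] [CompleteSpace H]
    [TopologicalSpace.SeparableSpace H]
    (s : ℝ) (hs : (d : ℝ) < s) (γ : ℝ) (hγ : γ = 1 - (d : ℝ) / s) (hγpos : 0 < γ) :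
    ∃ C > 0, ∀ A : ↥X → ↥X → (H →L[ℂ] H),
      BddAbove (Set.range fun q : ↥X × ↥X =>
        ‖A q.1 q.2‖ * (1 + ‖(q.1 : Euc d) - (q.2 : Euc d)‖) ^ s) →
      ∀ T : lp (fun _ : ↥X => H) 2 →L[ℂ] lp (fun _ : ↥X => H) 2,
      (∀ (f : lp (fun _ : ↥X => H) 2) (k : ↥X), T f k = ∑' l : ↥X, A k l (f l)) →
      ∀ k l : ↥X,
        Summable (fun n : ↥X => ‖(A k n) ∘L (A n l)‖) ∧
        ‖∑' n : ↥X, (A k n) ∘L (A n l)‖ * (1 + ‖(k : Euc d) - (l : Euc d)‖) ^ s ≤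
          C * jaffardNorm s A ^ (2 - γ) * ‖T‖ ^ γ := by
  obtain ⟨K, hK, hsum⟩ := hX.exists_sum_le_rpow_mul_rpow hs
  have hs0 : 0 < s := lt_of_le_of_lt (Nat.cast_nonneg d) hs
  refine ⟨2 ^ s * (2 * K), by positivity, fun A hA T hT k l => ?_⟩
  set J := jaffardNorm s A with hJdef
  have hAJ : ∀ k l : X, ‖A k l‖ * (1 + ‖(k : Euc d) - (l : Euc d)‖) ^ s ≤ J :=
    fun k l => le_ciSup hA (k, l)
  have hJ : 0 ≤ J := le_trans (by positivity) (hAJ k l)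
  have hAT := norm_entry_le_opNorm A T hT
  set w : ℝ := (1 + ‖(k : Euc d) - (l : Euc d)‖) ^ s
  have hw : 0 < w := by positivity
  set M : ℝ := K * (J ^ ((d : ℝ) / s) * ‖T‖ ^ (1 - (d : ℝ) / s))
  have hrow := hsum k J ‖T‖ (fun n => ‖A k n‖) hJ (norm_nonneg _) (fun _ => norm_nonneg _)
    (fun n => hAT k n) (fun n => by rw [norm_sub_rev]; exact hAJ k n)
  have hcol := hsum l J ‖T‖ (fun n => ‖A n l‖) hJ (norm_nonneg _) (fun _ => norm_nonneg _)
    (fun n => hAT n l) (fun n => hAJ n l)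
  have hfin : ∀ F : Finset X, ∑ n ∈ F, ‖(A k n) ∘L (A n l)‖ ≤ 2 ^ s * J * (M + M) / w := by
    intro F
    rw [le_div_iff₀ hw, Finset.sum_mul]
    calc ∑ n ∈ F, ‖(A k n) ∘L (A n l)‖ * w
        ≤ ∑ n ∈ F, 2 ^ s * J * (‖A k n‖ + ‖A n l‖) := by
          refine Finset.sum_le_sum fun n _ => ?_
          refine (mul_le_mul_of_nonneg_right
            (ContinuousLinearMap.opNorm_comp_le (A k n) (A n l)) hw.le).trans ?_
          exact mul_mul_rpow_le hs0 (norm_nonneg _) (norm_nonneg _) (norm_nonneg _)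
            (norm_nonneg _) (norm_nonneg _) (norm_sub_le_norm_sub_add_norm_sub _ _ _)
            (hAJ k n) (hAJ n l)
      _ = 2 ^ s * J * (∑ n ∈ F, ‖A k n‖ + ∑ n ∈ F, ‖A n l‖) := by
          rw [← Finset.mul_sum, Finset.sum_add_distrib]
      _ ≤ 2 ^ s * J * (M + M) := by
          gcongr
          exacts [hrow F, hcol F]
  have hsummable := summable_of_sum_le (fun n => norm_nonneg ((A k n) ∘L (A n l))) hfin
  refine ⟨hsummable, ?_⟩
  have htsum := (norm_tsum_le_tsum_norm hsummable).trans (hsummable.tsum_le_of_sum_le hfin)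
  rw [le_div_iff₀ hw] at htsum
  refine htsum.trans_eq ?_
  have hpow : J ^ (2 - γ) = J * J ^ ((d : ℝ) / s) := by
    rw [hγ, show 2 - (1 - (d : ℝ) / s) = 1 + (d : ℝ) / s by ring,
      Real.rpow_add_of_nonneg hJ zero_le_one (by positivity), Real.rpow_one]
  rw [hpow, hγ]
  ring
end
end

section
/- Let X ⊂ ℝ^d be a relatively separated set, δ ∈ (0,1], and ν_δ(x) = (1+|x|)^δ. Then for every B(H)-valued matrix A with finite Schur norm ‖A‖_{S_{ν_δ}^1} < ∞, the spectral radii agree: lim_{n→∞} ‖A^n‖_{S_{ν_δ}^1}^{1/n} = lim_{n→∞} ‖A^n‖_{S^1}^{1/n}, where A^n denotes the n-th matrix power (entrywise absolutely convergent) and both limits exist. -/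
open scoped ENNReal
open Set Filter

noncomputable section

/-- Membership in the Schur class `S_ν^1(X)`. -/
def MemSchur1 {d : ℕ} {X : Set (Euc d)} {H : Type*}
    [NormedAddCommGroup H] [InnerProductSpace ℂ H]
    (ν : Euc d → ℝ) (A : ↥X → ↥X → (H →L[ℂ] H)) : Prop :=
  (∀ k : ↥X, Summable fun l : ↥X => ‖A k l‖ * ν ((k : Euc d) - (l : Euc d))) ∧
  BddAbove (Set.range fun k : ↥X => ∑' l : ↥X, ‖A k l‖ * ν ((k : Euc d) - (l : Euc d))) ∧
  (∀ l : ↥X, Summable fun k : ↥X => ‖A k l‖ * ν ((k : Euc d) - (l : Euc d))) ∧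
  BddAbove (Set.range fun l : ↥X => ∑' k : ↥X, ‖A k l‖ * ν ((k : Euc d) - (l : Euc d)))

/-- The Schur norm `‖A‖_{S_ν^1}`. -/
noncomputable def schurNorm1 {d : ℕ} {X : Set (Euc d)} {H : Type*}
    [NormedAddCommGroup H] [InnerProductSpace ℂ H]
    (ν : Euc d → ℝ) (A : ↥X → ↥X → (H →L[ℂ] H)) : ℝ :=
  max (⨆ k : ↥X, ∑' l : ↥X, ‖A k l‖ * ν ((k : Euc d) - (l : Euc d)))
      (⨆ l : ↥X, ∑' k : ↥X, ‖A k l‖ * ν ((k : Euc d) - (l : Euc d)))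

/-- The matrix product `[AB]_{k,l} = Σ_n A_{k,n} B_{n,l}`. -/
noncomputable def matMul {X : Type*} {H : Type*}
    [NormedAddCommGroup H] [InnerProductSpace ℂ H] [CompleteSpace H]
    (A B : X → X → (H →L[ℂ] H)) : X → X → (H →L[ℂ] H) :=
  fun k l => ∑' n : X, (A k n) ∘L (B n l)

/-- `matPow A n` is the matrix power `A^(n+1)`. -/
noncomputable def matPow {X : Type*} {H : Type*}
    [NormedAddCommGroup H] [InnerProductSpace ℂ H] [CompleteSpace H]
    (A : X → X → (H →L[ℂ] H)) : ℕ → (X → X → (H →L[ℂ] H))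
  | 0 => A
  | n + 1 => matMul (matPow A n) A

/-- Row sums of a product of nonnegative kernels, for a weight dominated by
`u k n * v n l + u' k n * v' n l`. -/
lemma tsum_tsum_mul_weight_le {X : Type*} (a b w u v u' v' : X → X → ℝ≥0∞)
    (hw : ∀ k n l, w k l ≤ u k n * v n l + u' k n * v' n l) (k : X) :
    ∑' l, (∑' n, a k n * b n l) * w k l ≤
      (∑' n, a k n * u k n) * (⨆ n, ∑' l, b n l * v n l) +
      (∑' n, a k n * u' k n) * (⨆ n, ∑' l, b n l * v' n l) := by
  calc ∑' l, (∑' n, a k n * b n l) * w k l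
      ≤ ∑' l, ∑' n, (a k n * u k n * (b n l * v n l) + a k n * u' k n * (b n l * v' n l)) := by
        refine ENNReal.tsum_le_tsum fun l => ?_
        rw [← ENNReal.tsum_mul_right]
        refine ENNReal.tsum_le_tsum fun n => ?_
        calc a k n * b n l * w k l
            ≤ a k n * b n l * (u k n * v n l + u' k n * v' n l) := by gcongr; exact hw k n l
          _ = _ := by ring
    _ = ∑' n, ((a k n * u k n) * ∑' l, b n l * v n l) +
          ∑' n, ((a k n * u' k n) * ∑' l, b n l * v' n l) := by
        rw [ENNReal.tsum_comm, ← ENNReal.tsum_add]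
        refine tsum_congr fun n => ?_
        rw [ENNReal.tsum_add, ENNReal.tsum_mul_left, ENNReal.tsum_mul_left]
    _ ≤ _ := by
        rw [← ENNReal.tsum_mul_right, ← ENNReal.tsum_mul_right]
        refine add_le_add ?_ ?_ <;> refine ENNReal.tsum_le_tsum fun n => ?_ <;> gcongr
        · exact le_iSup (fun n => ∑' l, b n l * v n l) n
        · exact le_iSup (fun n => ∑' l, b n l * v' n l) n

/-- The Schur norm with values in `ℝ≥0∞`. -/
def schurENorm {X E : Type*} [NormedRing E] (w : X → X → ℝ≥0∞) (A : X → X → E) : ℝ≥0∞ :=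
  max (⨆ k, ∑' l, ‖A k l‖ₑ * w k l) (⨆ l, ∑' k, ‖A k l‖ₑ * w k l)

lemma enorm_mul_le_mul {E : Type*} [NormedRing E] (S T : E) : ‖S * T‖ₑ ≤ ‖S‖ₑ * ‖T‖ₑ := by
  simpa only [enorm, ← ENNReal.coe_mul, ENNReal.coe_le_coe] using nnnorm_mul_le S T

lemma tsum_enorm_row_le {X E : Type*} [NormedRing E] (A : X → X → E) (k : X) :
    ∑' l, ‖A k l‖ₑ ≤ schurENorm 1 A := by
  simp only [schurENorm, Pi.one_apply, mul_one]
  exact (le_iSup (fun k => ∑' l, ‖A k l‖ₑ) k).trans (le_max_left _ _)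

lemma enorm_entry_le {X E : Type*} [NormedRing E] (A : X → X → E) (k l : X) :
    ‖A k l‖ₑ ≤ schurENorm 1 A :=
  (ENNReal.le_tsum l).trans (tsum_enorm_row_le A k)

lemma summable_of_tsum_enorm_ne_top {ι E : Type*} [NormedAddCommGroup E] [CompleteSpace E]
    {f : ι → E} (h : ∑' i, ‖f i‖ₑ ≠ ∞) : Summable f :=
  Summable.of_nnnorm (ENNReal.tsum_coe_ne_top_iff_summable.1 h)

section

variable {X H : Type*} [NormedAddCommGroup H] [InnerProductSpace ℂ H] [CompleteSpace H]

lemma enorm_matMul_le (A B : X → X → (H →L[ℂ] H)) (k l : X) :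
    ‖matMul A B k l‖ₑ ≤ ∑' n, ‖A k n‖ₑ * ‖B n l‖ₑ :=
  (enorm_tsum_le_tsum_enorm (f := fun n => A k n * B n l)).trans
    (ENNReal.tsum_le_tsum fun _ => enorm_mul_le_mul _ _)

lemma schurENorm_matMul_le (A B : X → X → (H →L[ℂ] H)) (w u v u' v' : X → X → ℝ≥0∞)
    (hw : ∀ k n l, w k l ≤ u k n * v n l + u' k n * v' n l) :
    schurENorm w (matMul A B) ≤
      schurENorm u A * schurENorm v B + schurENorm u' A * schurENorm v' B := by
  refine max_le (iSup_le fun k => ?_) (iSup_le fun l => ?_)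
  · calc ∑' l, ‖matMul A B k l‖ₑ * w k l
        ≤ ∑' l, (∑' n, ‖A k n‖ₑ * ‖B n l‖ₑ) * w k l := by
          gcongr; exact enorm_matMul_le A B k _
      _ ≤ _ := tsum_tsum_mul_weight_le (fun k n => ‖A k n‖ₑ) (fun n l => ‖B n l‖ₑ) w u v u' v' hw k
      _ ≤ _ := by
          refine add_le_add (mul_le_mul' ?_ (le_max_left _ _)) (mul_le_mul' ?_ (le_max_left _ _))
          · exact (le_iSup (fun k => ∑' n, ‖A k n‖ₑ * u k n) k).trans (le_max_left _ _)
          · exact (le_iSup (fun k => ∑' n, ‖A k n‖ₑ * u' k n) k).trans (le_max_left _ _)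
  · calc ∑' k, ‖matMul A B k l‖ₑ * w k l
        ≤ ∑' k, (∑' n, ‖B n l‖ₑ * ‖A k n‖ₑ) * w k l := by
          gcongr with k
          simpa only [mul_comm] using enorm_matMul_le A B k l
      _ ≤ _ := tsum_tsum_mul_weight_le (fun l n => ‖B n l‖ₑ) (fun n k => ‖A k n‖ₑ)
          (fun l k => w k l) (fun l n => v n l) (fun n k => u k n) (fun l n => v' n l)
          (fun n k => u' k n) (fun l n k => by simpa only [mul_comm] using hw k n l) l
      _ ≤ _ := by
          rw [mul_comm (schurENorm u A), mul_comm (schurENorm u' A)]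
          refine add_le_add (mul_le_mul' ?_ (le_max_right _ _)) (mul_le_mul' ?_ (le_max_right _ _))
          · exact (le_iSup (fun l => ∑' n, ‖B n l‖ₑ * v n l) l).trans (le_max_right _ _)
          · exact (le_iSup (fun l => ∑' n, ‖B n l‖ₑ * v' n l) l).trans (le_max_right _ _)

lemma schurENorm_matMul_le_mul (A B : X → X → (H →L[ℂ] H)) (w : X → X → ℝ≥0∞)
    (hw : ∀ k n l, w k l ≤ w k n * w n l) :
    schurENorm w (matMul A B) ≤ schurENorm w A * schurENorm w B := by
  simpa [schurENorm] using
    schurENorm_matMul_le A B w w w 0 0 (fun k n l => by simpa using hw k n l)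

lemma summable_matMul (A B : X → X → (H →L[ℂ] H)) (hA : schurENorm 1 A ≠ ∞)
    (hB : schurENorm 1 B ≠ ∞) (k l : X) : Summable fun n => A k n * B n l := by
  refine summable_of_tsum_enorm_ne_top (ne_top_of_le_ne_top (ENNReal.mul_ne_top hA hB) ?_)
  calc ∑' n, ‖A k n * B n l‖ₑ ≤ ∑' n, ‖A k n‖ₑ * schurENorm 1 B :=
        ENNReal.tsum_le_tsum fun n => (enorm_mul_le_mul _ _).trans
          (mul_le_mul_right (enorm_entry_le B n l) _)
    _ ≤ _ := by
        rw [ENNReal.tsum_mul_right]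
        gcongr
        exact tsum_enorm_row_le A k

lemma matMul_assoc (A B C : X → X → (H →L[ℂ] H)) (hA : schurENorm 1 A ≠ ∞)
    (hB : schurENorm 1 B ≠ ∞) (hC : schurENorm 1 C ≠ ∞) :
    matMul (matMul A B) C = matMul A (matMul B C) := by
  funext k l
  have hs : Summable (Function.uncurry fun n m => A k n * (B n m * C m l)) := by
    refine summable_of_tsum_enorm_ne_top
      (ne_top_of_le_ne_top (ENNReal.mul_ne_top hA (ENNReal.mul_ne_top hB hC)) ?_)
    rw [ENNReal.tsum_prod']
    calc ∑' n, ∑' m, ‖A k n * (B n m * C m l)‖ₑ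
        ≤ ∑' n, ∑' m, ‖A k n‖ₑ * (‖B n m‖ₑ * schurENorm 1 C) := by
          refine ENNReal.tsum_le_tsum fun n => ENNReal.tsum_le_tsum fun m => ?_
          refine (enorm_mul_le_mul _ _).trans ?_
          gcongr
          refine (enorm_mul_le_mul _ _).trans ?_
          gcongr
          exact enorm_entry_le C m l
      _ ≤ ∑' n, ‖A k n‖ₑ * (schurENorm 1 B * schurENorm 1 C) := by
          refine ENNReal.tsum_le_tsum fun n => ?_
          rw [ENNReal.tsum_mul_left, ENNReal.tsum_mul_right]
          gcongr
          exact tsum_enorm_row_le B n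
      _ ≤ _ := by
          rw [ENNReal.tsum_mul_right]
          gcongr
          exact tsum_enorm_row_le A k
  calc ∑' m, (∑' n, A k n * B n m) * C m l
      = ∑' m, ∑' n, A k n * (B n m * C m l) := tsum_congr fun m => by
        rw [← (summable_matMul A B hA hB k m).tsum_mul_right]
        exact tsum_congr fun n => mul_assoc _ _ _
    _ = ∑' n, ∑' m, A k n * (B n m * C m l) := hs.tsum_comm
    _ = ∑' n, A k n * ∑' m, B n m * C m l := tsum_congr fun n =>
        (summable_matMul B C hB hC n l).tsum_mul_left _

lemma schurENorm_matPow_ne_top (A : X → X → (H →L[ℂ] H)) (w : X → X → ℝ≥0∞)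
    (hw : ∀ k n l, w k l ≤ w k n * w n l) (hA : schurENorm w A ≠ ∞) (n : ℕ) :
    schurENorm w (matPow A n) ≠ ∞ := by
  induction n with
  | zero => exact hA
  | succ n ih =>
    exact ne_top_of_le_ne_top (ENNReal.mul_ne_top ih hA) (schurENorm_matMul_le_mul _ _ w hw)

lemma matPow_add (A : X → X → (H →L[ℂ] H)) (hA : schurENorm 1 A ≠ ∞) (m n : ℕ) :
    matPow A (m + n + 1) = matMul (matPow A m) (matPow A n) := by
  have hfin := schurENorm_matPow_ne_top A 1 (by simp) hA
  induction n with
  | zero => rfl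
  | succ n ih =>
    calc matPow A (m + (n + 1) + 1) = matMul (matPow A (m + n + 1)) A := rfl
      _ = matMul (matPow A m) (matMul (matPow A n) A) := by
        rw [ih, matMul_assoc _ _ _ (hfin m) (hfin n) hA]

end

lemma schurNorm1_eq_toReal {d : ℕ} {X : Set (Euc d)} {H : Type*} [NormedAddCommGroup H]
    [InnerProductSpace ℂ H] (ν : Euc d → ℝ) (hν : ∀ x, 0 ≤ ν x) (A : X → X → (H →L[ℂ] H))
    (hA : schurENorm (fun k l : X => ENNReal.ofReal (ν (k - l))) A ≠ ∞) :
    schurNorm1 ν A = (schurENorm (fun k l : X => ENNReal.ofReal (ν (k - l))) A).toReal := by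
  have h1 := ne_top_of_le_ne_top hA (le_max_left _ _)
  have h2 := ne_top_of_le_ne_top hA (le_max_right _ _)
  have hr := fun k => ne_top_of_le_ne_top h1
    (le_iSup (fun k => ∑' l : X, ‖A k l‖ₑ * ENNReal.ofReal (ν (k - l))) k)
  have hc := fun l => ne_top_of_le_ne_top h2
    (le_iSup (fun l => ∑' k : X, ‖A k l‖ₑ * ENNReal.ofReal (ν (k - l))) l)
  rw [schurENorm, ENNReal.toReal_max h1 h2, ENNReal.toReal_iSup hr, ENNReal.toReal_iSup hc]
  have ht : ∀ k l : X, (‖A k l‖ₑ * ENNReal.ofReal (ν (k - l))).toReal = ‖A k l‖ * ν (k - l) :=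
    fun k l => by rw [ENNReal.toReal_mul, toReal_enorm, ENNReal.toReal_ofReal (hν _)]
  unfold schurNorm1
  congr 2 <;> funext k
  · rw [ENNReal.tsum_toReal_eq (fun l => ENNReal.ne_top_of_tsum_ne_top (hr k) l)]
    simp only [ht]
  · rw [ENNReal.tsum_toReal_eq (fun l => ENNReal.ne_top_of_tsum_ne_top (hc k) l)]
    simp only [ht]

lemma MemSchur1.schurENorm_ne_top {d : ℕ} {X : Set (Euc d)} {H : Type*} [NormedAddCommGroup H]
    [InnerProductSpace ℂ H] {ν : Euc d → ℝ} (hν : ∀ x, 0 ≤ ν x) {A : X → X → (H →L[ℂ] H)}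
    (hA : MemSchur1 ν A) :
    schurENorm (fun k l : X => ENNReal.ofReal (ν (k - l))) A ≠ ∞ := by
  obtain ⟨hr, ⟨C, hC⟩, hc, ⟨D, hD⟩⟩ := hA
  have ht : ∀ k l : X, ‖A k l‖ₑ * ENNReal.ofReal (ν (k - l)) =
      ENNReal.ofReal (‖A k l‖ * ν (k - l)) := fun k l => by
    rw [ENNReal.ofReal_mul (norm_nonneg _), ofReal_norm]
  have hpos : ∀ k l : X, 0 ≤ ‖A k l‖ * ν (k - l) := fun k l =>
    mul_nonneg (norm_nonneg _) (hν _)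
  simp only [schurENorm, ht]
  refine (max_lt (lt_of_le_of_lt (iSup_le fun k => ?_) (ENNReal.ofReal_lt_top (r := C)))
    (lt_of_le_of_lt (iSup_le fun l => ?_) (ENNReal.ofReal_lt_top (r := D)))).ne
  · rw [← ENNReal.ofReal_tsum_of_nonneg (hpos k) (hr k)]
    exact ENNReal.ofReal_le_ofReal (hC ⟨k, rfl⟩)
  · rw [← ENNReal.ofReal_tsum_of_nonneg (fun k => hpos k l) (hc l)]
    exact ENNReal.ofReal_le_ofReal (hD ⟨l, rfl⟩)

/-- Fekete's lemma for submultiplicative sequences bounded below by a geometric sequence. -/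
lemma exists_tendsto_rpow_of_submultiplicative_of_pow_le {b : ℕ → ℝ} {ε : ℝ} (hε : 0 < ε)
    (hb : ∀ n, ε ^ n ≤ b n) (hmul : ∀ m n, b (m + n) ≤ b m * b n) :
    ∃ r, Tendsto (fun n : ℕ => b n ^ (1 / (n : ℝ))) atTop (nhds r) := by
  have hpos : ∀ n, 0 < b n := fun n => (pow_pos hε n).trans_le (hb n)
  have hsub : Subadditive fun n => Real.log (b n) := fun m n => by
    rw [← Real.log_mul (hpos m).ne' (hpos n).ne']
    exact Real.log_le_log (hpos _) (hmul m n)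
  have hbdd : BddBelow (range fun n : ℕ => Real.log (b n) / n) := by
    refine ⟨min (Real.log ε) 0, ?_⟩
    rintro _ ⟨n, rfl⟩
    rcases n.eq_zero_or_pos with rfl | hn
    · simp
    · have hn' : (0 : ℝ) < n := by exact_mod_cast hn
      refine (min_le_left _ _).trans ((le_div_iff₀ hn').2 ?_)
      rw [mul_comm, ← Real.log_pow]
      exact Real.log_le_log (pow_pos hε n) (hb n)
  refine ⟨_, ((Real.continuous_exp.tendsto _).comp (hsub.tendsto_lim hbdd)).congr fun n => ?_⟩
  rw [Function.comp_apply, Real.rpow_def_of_pos (hpos n), mul_one_div]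

/-- Fekete's lemma for nonnegative submultiplicative sequences. -/
lemma exists_tendsto_rpow_of_submultiplicative {b : ℕ → ℝ} (hb : ∀ n, 0 ≤ b n)
    (hmul : ∀ m n, b (m + n) ≤ b m * b n) :
    ∃ r, Tendsto (fun n : ℕ => b n ^ (1 / (n : ℝ))) atTop (nhds r) := by
  have key : ∀ ε : ℝ, 0 < ε →
      ∃ r, Tendsto (fun n : ℕ => max (b n ^ (1 / (n : ℝ))) ε) atTop (nhds r) := by
    intro ε hε
    obtain ⟨r, hr⟩ := exists_tendsto_rpow_of_submultiplicative_of_pow_le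
      (b := fun n => max (b n) (ε ^ n)) hε (fun n => le_max_right _ _) (fun m n => by
        refine max_le ((hmul m n).trans ?_) ?_
        · exact mul_le_mul (le_max_left _ _) (le_max_left _ _) (hb n)
            ((hb m).trans (le_max_left _ _))
        · rw [pow_add]
          exact mul_le_mul (le_max_right _ _) (le_max_right _ _) (by positivity)
            ((hb m).trans (le_max_left _ _)))
    refine ⟨r, hr.congr' ?_⟩
    filter_upwards [eventually_ne_atTop 0] with n hn
    have hmono := Real.monotoneOn_rpow_Ici_of_exponent_nonneg
      (r := 1 / (n : ℝ)) (by positivity)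
    rw [hmono.map_max (hb n) (show ε ^ n ∈ Ici (0 : ℝ) from (pow_pos hε n).le), one_div,
      Real.pow_rpow_inv_natCast hε.le hn]
  by_cases h : ∃ ε : ℝ, 0 < ε ∧ ∃ r, ε < r ∧
      Tendsto (fun n : ℕ => max (b n ^ (1 / (n : ℝ))) ε) atTop (nhds r)
  · obtain ⟨ε, -, r, hεr, hr⟩ := h
    refine ⟨r, hr.congr' ?_⟩
    filter_upwards [hr.eventually (lt_mem_nhds hεr)] with n hn
    exact max_eq_left ((lt_max_iff.1 hn).resolve_right (lt_irrefl _)).le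
  · push Not at h
    refine ⟨0, tendsto_order.2 ⟨fun c hc => .of_forall fun n =>
      hc.trans_le (Real.rpow_nonneg (hb n) _), fun c hc => ?_⟩⟩
    obtain ⟨r, hr⟩ := key (c / 2) (half_pos hc)
    have hrc : r ≤ c / 2 := by
      by_contra! hlt
      exact h _ (half_pos hc) r hlt hr
    filter_upwards [hr.eventually (gt_mem_nhds (hrc.trans_lt (half_lt_self hc)))] with n hn
    exact (le_max_left _ _).trans_lt hn

/-- Brandenburg's trick: the doubling inequality `b (2n) ≤ 2 a n b n` forces equal growth rates. -/
lemma eq_of_tendsto_rpow_of_doubling {a b : ℕ → ℝ} {r s : ℝ} (ha : ∀ n, 0 ≤ a n)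
    (hab : ∀ n, a n ≤ b n) (hdouble : ∀ n, 0 < n → b (n + n) ≤ 2 * a n * b n)
    (hr : Tendsto (fun n : ℕ => a n ^ (1 / (n : ℝ))) atTop (nhds r))
    (hs : Tendsto (fun n : ℕ => b n ^ (1 / (n : ℝ))) atTop (nhds s)) : r = s := by
  have hb : ∀ n, 0 ≤ b n := fun n => (ha n).trans (hab n)
  have hrs : r ≤ s := le_of_tendsto_of_tendsto' hr hs fun n =>
    Real.rpow_le_rpow (ha n) (hab n) (by positivity)
  have hr0 : 0 ≤ r := ge_of_tendsto' hr fun n => Real.rpow_nonneg (ha n) _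
  have htwo : Tendsto (fun n : ℕ => (2 : ℝ) ^ (1 / (n : ℝ))) atTop (nhds 1) := by
    simpa [Function.comp_def] using
      ((Real.continuous_const_rpow (two_ne_zero (α := ℝ))).tendsto 0).comp
        tendsto_one_div_atTop_nhds_zero_nat
  have hdbl : Tendsto (fun n : ℕ => n + n) atTop atTop :=
    tendsto_atTop_mono (fun n => Nat.le_add_left n n) tendsto_id
  have hsq : s ^ 2 ≤ 1 * r * s := by
    refine le_of_tendsto_of_tendsto ((hs.comp hdbl).pow 2) ((htwo.mul hr).mul hs) ?_
    filter_upwards [eventually_gt_atTop 0] with n hn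
    have hn' : (n : ℝ) ≠ 0 := by positivity
    simp only [Function.comp_apply]
    rw [← Real.rpow_natCast, ← Real.rpow_mul (hb _),
      show 1 / ((n + n : ℕ) : ℝ) * ((2 : ℕ) : ℝ) = 1 / (n : ℝ) by push_cast; field_simp; norm_num,
      ← Real.mul_rpow zero_le_two (ha n),
      ← Real.mul_rpow (mul_nonneg zero_le_two (ha n)) (hb n)]
    exact Real.rpow_le_rpow (hb _) (hdouble n hn) (by positivity)
  nlinarith

lemma one_add_norm_rpow_mul {E : Type*} [SeminormedAddCommGroup E] {δ : ℝ} (hδ : 0 ≤ δ)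
    (x y : E) : (1 + ‖x + y‖) ^ δ ≤ (1 + ‖x‖) ^ δ * (1 + ‖y‖) ^ δ := by
  rw [← Real.mul_rpow (by positivity) (by positivity)]
  refine Real.rpow_le_rpow (by positivity) ?_ hδ
  nlinarith [norm_add_le x y, mul_nonneg (norm_nonneg x) (norm_nonneg y)]

lemma one_add_norm_rpow_add {E : Type*} [SeminormedAddCommGroup E] {δ : ℝ} (hδ : 0 ≤ δ)
    (hδ1 : δ ≤ 1) (x y : E) : (1 + ‖x + y‖) ^ δ ≤ (1 + ‖x‖) ^ δ + (1 + ‖y‖) ^ δ := by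
  refine le_trans (Real.rpow_le_rpow (by positivity) ?_ hδ)
    (Real.rpow_add_le_add_rpow (by positivity) (by positivity) hδ hδ1)
  linarith [norm_add_le x y]

theorem statement10 {d : ℕ} (X : Set (Euc d)) (hX : RelSep X)
    (H : Type*) [NormedAddCommGroup H] [InnerProductSpace ℂ H] [CompleteSpace H]
    [TopologicalSpace.SeparableSpace H]
    (δ : ℝ) (hδ0 : 0 < δ) (hδ1 : δ ≤ 1)
    (A : ↥X → ↥X → (H →L[ℂ] H))
    (hA : MemSchur1 (fun x : Euc d => (1 + ‖x‖) ^ δ) A) :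
    ∃ r : ℝ,
      Tendsto (fun n : ℕ =>
          (schurNorm1 (fun x : Euc d => (1 + ‖x‖) ^ δ) (matPow A n)) ^ (1 / ((n : ℝ) + 1)))
        atTop (nhds r) ∧
      Tendsto (fun n : ℕ =>
          (schurNorm1 (fun _ : Euc d => (1 : ℝ)) (matPow A n)) ^ (1 / ((n : ℝ) + 1)))
        atTop (nhds r) := by
  have hν : ∀ x : Euc d, 0 ≤ (1 + ‖x‖) ^ δ := fun x => by positivity
  set w : X → X → ℝ≥0∞ := fun k l => ENNReal.ofReal ((1 + ‖(k - l : Euc d)‖) ^ δ) with hwdef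
  have hwmul : ∀ k n l, w k l ≤ w k n * w n l := fun k n l => by
    simp only [hwdef]
    rw [← ENNReal.ofReal_mul (hν _), ← sub_add_sub_cancel (k : Euc d) n l]
    exact ENNReal.ofReal_le_ofReal (one_add_norm_rpow_mul hδ0.le _ _)
  have hwadd : ∀ k n l, w k l ≤ w k n * (1 : X → X → ℝ≥0∞) n l +
      (1 : X → X → ℝ≥0∞) k n * w n l := fun k n l => by
    simp only [hwdef, Pi.one_apply, mul_one, one_mul]
    rw [← ENNReal.ofReal_add (hν _) (hν _), ← sub_add_sub_cancel (k : Euc d) n l]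
    exact ENNReal.ofReal_le_ofReal (one_add_norm_rpow_add hδ0.le hδ1 _ _)
  have hw1 : ∀ k l, 1 ≤ w k l := fun k l =>
    ENNReal.one_le_ofReal.2 (Real.one_le_rpow (by linarith [norm_nonneg (k - l : Euc d)]) hδ0.le)
  have hle : ∀ B : X → X → (H →L[ℂ] H), schurENorm 1 B ≤ schurENorm w B := fun B => by
    unfold schurENorm
    gcongr <;> exact hw1 _ _
  have hAw : schurENorm w A ≠ ∞ := hA.schurENorm_ne_top hν
  have hA1 : schurENorm 1 A ≠ ∞ := ne_top_of_le_ne_top hAw (hle A)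
  have hfw := schurENorm_matPow_ne_top A w hwmul hAw
  have hf1 := schurENorm_matPow_ne_top A 1 (by simp) hA1
  have hone : (fun _ _ : X => ENNReal.ofReal 1) = 1 := by ext; simp
  have heq1 : ∀ n, schurNorm1 (fun _ : Euc d => (1 : ℝ)) (matPow A n) =
      (schurENorm 1 (matPow A n)).toReal := fun n => by
    rw [schurNorm1_eq_toReal _ (fun _ => zero_le_one) _ (by rw [hone]; exact hf1 n), hone]
  have heqw : ∀ n, schurNorm1 (fun x : Euc d => (1 + ‖x‖) ^ δ) (matPow A n) =
      (schurENorm w (matPow A n)).toReal := fun n =>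
    schurNorm1_eq_toReal _ hν _ (hfw n)
  simp only [heq1, heqw]
  -- `N v n` is the norm of the `n`-th power, with `N v 0 = 1`
  let N : (X → X → ℝ≥0∞) → ℕ → ℝ := fun v n =>
    Nat.casesOn n 1 fun m => (schurENorm v (matPow A m)).toReal
  have hN0 : ∀ v n, 0 ≤ N v n := fun v n => by
    cases n with
    | zero => exact zero_le_one
    | succ n => exact ENNReal.toReal_nonneg
  have hNmul : ∀ v : X → X → ℝ≥0∞, (∀ k n l, v k l ≤ v k n * v n l) → schurENorm v A ≠ ∞ →
      ∀ m n, N v (m + n) ≤ N v m * N v n := fun v hv hvA m n => by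
    rcases m with _ | m
    · simp [N]
    rcases n with _ | n
    · simp [N]
    have hfin := schurENorm_matPow_ne_top A v hv hvA
    show (schurENorm v (matPow A (m + 1 + n))).toReal ≤ _
    rw [show m + 1 + n = m + n + 1 by omega, matPow_add A hA1]
    simp only [N]
    rw [← ENNReal.toReal_mul]
    exact ENNReal.toReal_mono (ENNReal.mul_ne_top (hfin m) (hfin n))
      (schurENorm_matMul_le_mul _ _ v hv)
  obtain ⟨r, hr⟩ := exists_tendsto_rpow_of_submultiplicative (hN0 1)
    (hNmul 1 (by simp) hA1)
  obtain ⟨s, hs⟩ := exists_tendsto_rpow_of_submultiplicative (hN0 w) (hNmul w hwmul hAw)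
  have hrs : r = s := by
    refine eq_of_tendsto_rpow_of_doubling (hN0 1) (fun n => ?_) (fun n hn => ?_) hr hs
    · cases n with
      | zero => exact le_rfl
      | succ n => exact ENNReal.toReal_mono (hfw n) (hle _)
    · obtain ⟨n, rfl⟩ := Nat.exists_eq_succ_of_ne_zero hn.ne'
      show (schurENorm w (matPow A (n + 1 + n))).toReal ≤
        2 * (schurENorm 1 (matPow A n)).toReal * (schurENorm w (matPow A n)).toReal
      rw [show n + 1 + n = n + n + 1 by omega, matPow_add A hA1]
      have h := schurENorm_matMul_le (matPow A n) (matPow A n) w w 1 1 w hwadd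
      have hm := ENNReal.mul_ne_top (hf1 n) (hfw n)
      rw [mul_comm (schurENorm w _)] at h
      have h' := ENNReal.toReal_mono (ENNReal.add_ne_top.2 ⟨hm, hm⟩) h
      rw [ENNReal.toReal_add hm hm, ENNReal.toReal_mul] at h'
      linarith
  subst hrs
  exact ⟨r, by simpa [N, Function.comp_def] using hs.comp (tendsto_add_atTop_nat 1),
    by simpa [N, Function.comp_def] using hr.comp (tendsto_add_atTop_nat 1)⟩
end
end

section
/- Let X ⊂ ℝ^d be a relatively separated set, δ ∈ (0,1], and ν_δ(x) = (1+|x|)^δ. Then: (i) for every self-adjoint B(H)-valued matrix A (i.e. A_{l,k} = A_{k,l}^* for all k,l ∈ X) with finite Schur norm ‖A‖_{S_{ν_δ}^1} < ∞, one has lim_{n→∞} ‖A^n‖_{S_{ν_δ}^1}^{1/n} = lim_{n→∞} ‖A^n‖_{S^1}^{1/n} = r(A), where r(A) is the spectral radius of the bounded operator on ℓ²(X;H) defined by A (which equals its operator norm); and (ii) S_{ν_δ}^1(X) is inverse-closed in B(ℓ²(X;H)): if A has finite S_{ν_δ}^1 norm and the operator it defines on ℓ²(X;H) is invertible, then the canonical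 matrix representation of the inverse operator also has finite S_{ν_δ}^1 norm. -/
open scoped ENNReal NNReal
open Set Filter

noncomputable section

/-- The sequence `δ_l f ∈ ℓ^p(X;H)` equal to `f` at index `l` and `0` elsewhere. -/
noncomputable def deltaSeq {X : Type*} {H : Type*} [NormedAddCommGroup H]
    (p : ℝ≥0∞) (l : X) (f : H) : lp (fun _ : X => H) p :=
  haveI := Classical.decEq X
  lp.single p l f


/-- A submultiplicative sequence `a` whose values at doubled indices are controlled by
`K s ^ n a n + K τ ^ n (a n) ^ 2` with `τ < 1` grows no faster than `s ^ n`. -/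
lemma eventually_le_pow_of_doubling {a : ℕ → ℝ}
    (hmul : ∀ m n, a (m + n) ≤ a m * a n) (ha : ∀ n, 0 ≤ a n)
    {s σ τ K : ℝ} (hs : 0 < s) (hsσ : s < σ) (hτ0 : 0 ≤ τ) (hτ : τ < 1)
    (hK : ∀ n, a (2 * n) ≤ K * s ^ n * a n + K * τ ^ n * a n ^ 2) :
    ∀ᶠ n in atTop, a n ≤ σ ^ n := by
  set b : ℕ → ℝ := fun n => max (a n) (s ^ n) with hb
  have hbs : ∀ n, s ^ n ≤ b n := fun n => le_max_right _ _
  have hab : ∀ n, a n ≤ b n := fun n => le_max_left _ _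
  have hb0 : ∀ n, 0 < b n := fun n => (pow_pos hs n).trans_le (hbs n)
  have hbmul : ∀ m n, b (m + n) ≤ b m * b n := fun m n => by
    refine max_le ((hmul m n).trans ?_) ?_
    · exact mul_le_mul (hab m) (hab n) (ha n) (hb0 m).le
    · rw [pow_add]
      exact mul_le_mul (hbs m) (hbs n) (pow_pos hs n).le (hb0 m).le
  have hsub : Subadditive fun n => Real.log (b n) := fun m n => by
    rw [← Real.log_mul (hb0 m).ne' (hb0 n).ne']
    exact Real.log_le_log (hb0 _) (hbmul m n)
  have hbdd : BddBelow (range fun n : ℕ => Real.log (b n) / n) := by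
    refine ⟨min 0 (Real.log s), ?_⟩
    rintro _ ⟨n, rfl⟩
    rcases Nat.eq_zero_or_pos n with rfl | hn
    · simp
    · refine (min_le_right _ _).trans ?_
      have hn' : (0 : ℝ) < n := by exact_mod_cast hn
      show Real.log s ≤ Real.log (b n) / n
      rw [le_div_iff₀ hn', mul_comm, ← Real.log_pow]
      exact Real.log_le_log (pow_pos hs n) (hbs n)
  have hlim := hsub.tendsto_lim hbdd
  set L := hsub.lim with hL
  have hLs : L < Real.log σ := by
    refine lt_of_le_of_lt ?_ (Real.log_lt_log hs hsσ)
    by_contra! hlt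
    set K' := max K 1 with hK'
    have hdouble : ∀ n, b (2 * n) ≤ K' * s ^ n * b n + K' * τ ^ n * b n ^ 2 := fun n => by
      have h1 : K ≤ K' := le_max_left _ _
      have h2 : 1 ≤ K' := le_max_right _ _
      have := pow_pos hs n
      have := pow_nonneg hτ0 n
      have := hb0 n
      have := ha n
      have := hab n
      refine max_le ((hK n).trans ?_) ?_
      · gcongr
      · calc s ^ (2 * n) = 1 * s ^ n * s ^ n := by ring
          _ ≤ K' * s ^ n * b n := by gcongr; exact hbs n
          _ ≤ _ := le_add_of_nonneg_right (by positivity)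
    have hexp : ∀ n : ℕ, n ≠ 0 → Real.exp (L * n) ≤ b n := fun n hn => by
      have := hsub.lim_le_div hbdd hn
      rw [le_div_iff₀ (by positivity)] at this
      rw [← Real.le_log_iff_exp_le (hb0 n)]
      exact this
    obtain ⟨ε, hε, hε1, hε2⟩ : ∃ ε > 0, ε < L - Real.log s ∧ τ * Real.exp (2 * ε) < 1 := by
      have hc : Tendsto (fun ε => τ * Real.exp (2 * ε)) (nhdsWithin 0 (Ioi 0)) (nhds τ) := by
        have : Continuous fun ε : ℝ => τ * Real.exp (2 * ε) := by fun_prop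
        simpa using (this.tendsto 0).mono_left nhdsWithin_le_nhds
      have h1 := hc.eventually_lt_const hτ
      have h2 : ∀ᶠ ε in nhdsWithin (0 : ℝ) (Ioi 0), ε < L - Real.log s :=
        (tendsto_id.mono_left nhdsWithin_le_nhds).eventually_lt_const (by simpa using hlt)
      obtain ⟨ε, h, h', h''⟩ := (h1.and (h2.and self_mem_nhdsWithin)).exists
      exact ⟨ε, h'', h', h⟩
    have hup : ∀ᶠ n : ℕ in atTop, b n ≤ Real.exp ((L + ε) * n) := by
      filter_upwards [hlim.eventually_lt_const (show L < L + ε by linarith), eventually_gt_atTop 0]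
        with n hn hn0
      rw [div_lt_iff₀ (by exact_mod_cast hn0)] at hn
      rw [← Real.log_le_iff_le_exp (hb0 n)]
      exact hn.le
    have key : ∀ᶠ n : ℕ in atTop,
        1 ≤ K' * (s * Real.exp (ε - L)) ^ n + K' * (τ * Real.exp (2 * ε)) ^ n := by
      filter_upwards [hup, eventually_gt_atTop 0] with n hn hn0
      have h1 := (hexp (2 * n) (by omega)).trans (hdouble n)
      have h2 : b n ^ 2 ≤ Real.exp ((L + ε) * n) ^ 2 := pow_le_pow_left₀ (hb0 n).le hn 2
      have hK0 : 0 < K' := lt_of_lt_of_le one_pos (le_max_right _ _)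
      have h3 : Real.exp (L * (2 * n : ℕ)) ≤
          K' * s ^ n * Real.exp ((L + ε) * n) + K' * τ ^ n * Real.exp ((L + ε) * n) ^ 2 := by
        refine h1.trans ?_
        gcongr
      have h4 : K' * s ^ n * Real.exp ((L + ε) * n) + K' * τ ^ n * Real.exp ((L + ε) * n) ^ 2 =
          (K' * (s * Real.exp (ε - L)) ^ n + K' * (τ * Real.exp (2 * ε)) ^ n) *
            Real.exp (L * (2 * n : ℕ)) := by
        rw [mul_pow, mul_pow, ← Real.exp_nat_mul, ← Real.exp_nat_mul, ← Real.exp_nat_mul]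
        have e1 : Real.exp ((L + ε) * n) = Real.exp (n * (ε - L)) * Real.exp (L * (2 * n : ℕ)) := by
          rw [← Real.exp_add]; congr 1; push_cast; ring
        have e2 : Real.exp ((2 : ℕ) * ((L + ε) * n)) =
            Real.exp (n * (2 * ε)) * Real.exp (L * (2 * n : ℕ)) := by
          rw [← Real.exp_add]; congr 1; push_cast; ring
        rw [e1, e2]; ring
      rw [h4] at h3
      exact le_of_mul_le_mul_right (by simpa using h3) (Real.exp_pos _)
    have hr1 : s * Real.exp (ε - L) < 1 := by
      rw [← Real.exp_log hs, ← Real.exp_add]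
      exact (Real.exp_lt_exp.2 (by linarith)).trans_eq Real.exp_zero
    have hz : Tendsto (fun n : ℕ =>
        K' * (s * Real.exp (ε - L)) ^ n + K' * (τ * Real.exp (2 * ε)) ^ n) atTop (nhds 0) := by
      have h1 := (tendsto_pow_atTop_nhds_zero_of_lt_one (by positivity) hr1).const_mul K'
      have h2 := (tendsto_pow_atTop_nhds_zero_of_lt_one (by positivity) hε2).const_mul K'
      simpa using h1.add h2
    obtain ⟨n, h1, h2⟩ := (key.and (hz.eventually_lt_const one_pos)).exists
    linarith
  filter_upwards [hlim.eventually_lt_const hLs, eventually_gt_atTop 0] with n hn hn0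
  rw [div_lt_iff₀ (by exact_mod_cast hn0), mul_comm, ← Real.log_pow] at hn
  exact (hab n).trans ((Real.log_lt_log_iff (hb0 n) (pow_pos (hs.trans hsσ) n)).1 hn).le

lemma RelSep.exists_encard_le {d : ℕ} {X : Set (Euc d)} (hX : RelSep X) :
    ∃ N : ℕ, ∀ (x : Euc d) (m : ℕ),
      {l : ↥X | ‖x - (l : Euc d)‖ ≤ m}.encard ≤ ((2 * m + 1) ^ d * N : ℕ) := by
  classical
  obtain ⟨N, hN⟩ := hX
  refine ⟨N, fun x m => ?_⟩
  let t : Finset (Fin d → ℤ) := Fintype.piFinset fun _ => Finset.Icc (-(m : ℤ)) m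
  let Q : (Fin d → ℤ) → Set (Euc d) := fun z =>
    X ∩ {y | ∀ j, (WithLp.toLp 2 fun i => x i + z i : Euc d) j ≤ y j ∧
      y j ≤ (WithLp.toLp 2 fun i => x i + z i : Euc d) j + 1}
  have ht : t.card = (2 * m + 1) ^ d := by
    rw [Fintype.card_piFinset_const, Int.card_Icc]
    congr 1
    omega
  have hQ : ∀ z, (Q z).encard ≤ N := fun z => by
    have h := hN (WithLp.toLp 2 fun i => x i + z i)
    rw [← h.1.cast_ncard_eq]
    exact_mod_cast h.2
  have hcov : Subtype.val '' {l : ↥X | ‖x - (l : Euc d)‖ ≤ m} ⊆ ⋃ z ∈ t, Q z := by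
    rintro _ ⟨l, hl, rfl⟩
    simp only [mem_iUnion]
    refine ⟨fun j => ⌊(l : Euc d) j - x j⌋, ?_, l.2, fun j => ⟨?_, ?_⟩⟩
    · rw [Fintype.mem_piFinset]
      intro j
      have h1 : |(x - (l : Euc d)) j| ≤ m :=
        (PiLp.norm_apply_le (x - (l : Euc d)) j).trans hl
      rw [PiLp.sub_apply, abs_le] at h1
      rw [Finset.mem_Icc, Int.le_floor]
      refine ⟨by push_cast; linarith, ?_⟩
      have := Int.floor_le ((l : Euc d) j - x j)
      have h2 : (⌊(l : Euc d) j - x j⌋ : ℝ) ≤ (m : ℤ) := by push_cast; linarith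
      exact_mod_cast h2
    · have := Int.floor_le ((l : Euc d) j - x j)
      simp only
      linarith
    · have := Int.lt_floor_add_one ((l : Euc d) j - x j)
      simp only
      linarith
  calc {l : ↥X | ‖x - (l : Euc d)‖ ≤ m}.encard
      = (Subtype.val '' {l : ↥X | ‖x - (l : Euc d)‖ ≤ m}).encard :=
        (Subtype.val_injective.encard_image _).symm
    _ ≤ (⋃ z ∈ t, Q z).encard := encard_le_encard hcov
    _ ≤ ∑ z ∈ t, (Q z).encard := t.set_encard_biUnion_le Q
    _ ≤ ∑ _z ∈ t, (N : ℕ∞) := Finset.sum_le_sum fun z _ => hQ z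
    _ = ((2 * m + 1) ^ d * N : ℕ) := by
      rw [Finset.sum_const, ht]; push_cast; simp

/-- The number of points of `X` at which the weight `(1 + |x - ·|) ^ δ` is at most `V` grows at
most polynomially in `V`. -/
lemma RelSep.exists_encard_weight_le {d : ℕ} {X : Set (Euc d)} (hX : RelSep X)
    {δ : ℝ} (hδ : 0 < δ) :
    ∃ D m : ℕ, ∀ (x : Euc d) (V : ℝ), 1 ≤ V →
      ({l : ↥X | (1 + ‖x - (l : Euc d)‖) ^ δ ≤ V}.encard : ℝ≥0∞) ≤ ENNReal.ofReal (D * V ^ m) := by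
  obtain ⟨N, hN⟩ := hX.exists_encard_le
  obtain ⟨m, hm⟩ := exists_nat_ge (d / δ)
  refine ⟨5 ^ d * N, m, fun x V hV => ?_⟩
  have hV0 : 0 ≤ V := zero_le_one.trans hV
  set R : ℝ := V ^ (1 / δ) with hR
  have hR1 : 1 ≤ R := Real.one_le_rpow hV (by positivity)
  have hsub : {l : ↥X | (1 + ‖x - (l : Euc d)‖) ^ δ ≤ V} ⊆
      {l : ↥X | ‖x - (l : Euc d)‖ ≤ ⌈R⌉₊} := fun l hl => by
    have h1 : 1 + ‖x - (l : Euc d)‖ ≤ R := by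
      rw [hR, one_div, Real.le_rpow_inv_iff_of_pos (by positivity) hV0 hδ]
      exact hl
    have := Nat.le_ceil R
    show ‖x - (l : Euc d)‖ ≤ ⌈R⌉₊
    linarith
  have h1 := (encard_le_encard hsub).trans (hN x ⌈R⌉₊)
  have hceil : (⌈R⌉₊ : ℝ) ≤ 2 * R := by
    have := Nat.ceil_lt_add_one (zero_le_one.trans hR1)
    linarith
  have hRd : R ^ d ≤ V ^ m := by
    rw [hR, ← Real.rpow_natCast, ← Real.rpow_mul hV0, ← Real.rpow_natCast V m]
    exact Real.rpow_le_rpow_of_exponent_le hV (by rw [one_div_mul_eq_div]; exact hm)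
  have h2 : (((2 * ⌈R⌉₊ + 1) ^ d * N : ℕ) : ℝ) ≤ ((5 ^ d * N : ℕ) : ℝ) * V ^ m := by
    push_cast
    calc (2 * (⌈R⌉₊ : ℝ) + 1) ^ d * N ≤ (5 * R) ^ d * N := by gcongr; linarith
      _ = 5 ^ d * N * R ^ d := by rw [mul_pow]; ring
      _ ≤ _ := by gcongr
  calc ({l : ↥X | (1 + ‖x - (l : Euc d)‖) ^ δ ≤ V}.encard : ℝ≥0∞)
      ≤ (((2 * ⌈R⌉₊ + 1) ^ d * N : ℕ) : ℕ∞) := by exact_mod_cast h1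
    _ = ENNReal.ofReal (((2 * ⌈R⌉₊ + 1) ^ d * N : ℕ) : ℝ) := by
      rw [ENNReal.ofReal_natCast]; rfl
    _ ≤ _ := ENNReal.ofReal_le_ofReal h2

/-- The Schur norm of a matrix of extended nonnegative numbers. -/
def kernelSchur {ι : Type*} (a : ι → ι → ℝ≥0∞) : ℝ≥0∞ :=
  max (⨆ k, ∑' l, a k l) (⨆ l, ∑' k, a k l)

section KernelSchur

variable {ι : Type*} {a b : ι → ι → ℝ≥0∞}

lemma kernelSchur_le_iff {c : ℝ≥0∞} :
    kernelSchur a ≤ c ↔ (∀ k, ∑' l, a k l ≤ c) ∧ ∀ l, ∑' k, a k l ≤ c := by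
  simp [kernelSchur]

lemma row_le_kernelSchur (a : ι → ι → ℝ≥0∞) (k : ι) : ∑' l, a k l ≤ kernelSchur a :=
  (kernelSchur_le_iff.1 le_rfl).1 k

lemma col_le_kernelSchur (a : ι → ι → ℝ≥0∞) (l : ι) : ∑' k, a k l ≤ kernelSchur a :=
  (kernelSchur_le_iff.1 le_rfl).2 l

lemma kernelSchur_mono (h : ∀ k l, a k l ≤ b k l) : kernelSchur a ≤ kernelSchur b :=
  kernelSchur_le_iff.2 ⟨fun k => (ENNReal.tsum_le_tsum (h k)).trans (row_le_kernelSchur b k),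
    fun l => (ENNReal.tsum_le_tsum fun k => h k l).trans (col_le_kernelSchur b l)⟩

lemma kernelSchur_transpose (a : ι → ι → ℝ≥0∞) : kernelSchur (fun k l => a l k) = kernelSchur a :=
  max_comm _ _

lemma kernelSchur_add_le (a b : ι → ι → ℝ≥0∞) :
    kernelSchur (fun k l => a k l + b k l) ≤ kernelSchur a + kernelSchur b := by
  refine kernelSchur_le_iff.2 ⟨fun k => ?_, fun l => ?_⟩ <;> rw [ENNReal.tsum_add]
  · exact add_le_add (row_le_kernelSchur a k) (row_le_kernelSchur b k)
  · exact add_le_add (col_le_kernelSchur a l) (col_le_kernelSchur b l)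

lemma kernelSchur_tsum_le (a : ℕ → ι → ι → ℝ≥0∞) :
    kernelSchur (fun k l => ∑' n, a n k l) ≤ ∑' n, kernelSchur (a n) := by
  refine kernelSchur_le_iff.2 ⟨fun k => ?_, fun l => ?_⟩ <;> rw [ENNReal.tsum_comm]
  · exact ENNReal.tsum_le_tsum fun n => row_le_kernelSchur (a n) k
  · exact ENNReal.tsum_le_tsum fun n => col_le_kernelSchur (a n) l

lemma kernelSchur_const_mul_le (c : ℝ≥0∞) (a : ι → ι → ℝ≥0∞) :
    kernelSchur (fun k l => c * a k l) ≤ c * kernelSchur a := by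
  refine kernelSchur_le_iff.2 ⟨fun k => ?_, fun l => ?_⟩ <;> rw [ENNReal.tsum_mul_left]
  · gcongr; exact row_le_kernelSchur a k
  · gcongr; exact col_le_kernelSchur a l

lemma kernelSchur_mul_le (a b : ι → ι → ℝ≥0∞) :
    kernelSchur (fun k l => ∑' n, a k n * b n l) ≤ kernelSchur a * kernelSchur b := by
  refine kernelSchur_le_iff.2 ⟨fun k => ?_, fun l => ?_⟩ <;> rw [ENNReal.tsum_comm]
  · calc ∑' n, ∑' l, a k n * b n l = ∑' n, a k n * ∑' l, b n l := by
          simp_rw [ENNReal.tsum_mul_left]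
      _ ≤ ∑' n, a k n * kernelSchur b := by gcongr; exact row_le_kernelSchur b _
      _ ≤ _ := by rw [ENNReal.tsum_mul_right]; gcongr; exact row_le_kernelSchur a k
  · calc ∑' n, ∑' k, a k n * b n l = ∑' n, (∑' k, a k n) * b n l := by
          simp_rw [ENNReal.tsum_mul_right]
      _ ≤ ∑' n, kernelSchur a * b n l := by gcongr; exact col_le_kernelSchur a _
      _ ≤ _ := by rw [ENNReal.tsum_mul_left]; gcongr; exact col_le_kernelSchur b l

lemma ENNReal.two_mul_mul_le_add_sq (x y : ℝ≥0∞) : 2 * (x * y) ≤ x ^ 2 + y ^ 2 := by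
  rcases eq_or_ne x ⊤ with rfl | hx
  · simp
  rcases eq_or_ne y ⊤ with rfl | hy
  · simp
  lift x to ℝ≥0 using hx
  lift y to ℝ≥0 using hy
  have := two_mul_le_add_sq x y
  rw [mul_assoc] at this
  exact_mod_cast this

lemma ENNReal.sq_tsum_mul_le (u v : ι → ℝ≥0∞) :
    (∑' l, u l * v l) ^ 2 ≤ (∑' l, u l) * ∑' l, u l * v l ^ 2 := by
  have h : 2 * (∑' l, u l * v l) ^ 2 ≤ 2 * ((∑' l, u l) * ∑' l, u l * v l ^ 2) := by
    calc 2 * (∑' l, u l * v l) ^ 2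
        = ∑' l, ∑' m, u l * u m * (2 * (v l * v m)) := by
          rw [sq, ← ENNReal.tsum_mul_right, ← ENNReal.tsum_mul_left]
          refine tsum_congr fun l => ?_
          rw [← ENNReal.tsum_mul_left, ← ENNReal.tsum_mul_left]
          refine tsum_congr fun m => ?_
          ring
      _ ≤ ∑' l, ∑' m, u l * u m * (v l ^ 2 + v m ^ 2) := by
          gcongr; exact ENNReal.two_mul_mul_le_add_sq _ _
      _ = ∑' l, (u l * v l ^ 2 * ∑' m, u m) + ∑' l, u l * ∑' m, u m * v m ^ 2 := by
          rw [← ENNReal.tsum_add]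
          refine tsum_congr fun l => ?_
          rw [← ENNReal.tsum_mul_left, ← ENNReal.tsum_mul_left, ← ENNReal.tsum_add]
          refine tsum_congr fun m => ?_
          ring
      _ = _ := by
          rw [ENNReal.tsum_mul_right, ENNReal.tsum_mul_right]
          ring
  exact (ENNReal.mul_le_mul_iff_right two_ne_zero ENNReal.ofNat_ne_top).1 h

/-- Schur's test. -/
lemma tsum_sq_tsum_mul_le (a : ι → ι → ℝ≥0∞) (v : ι → ℝ≥0∞) :
    ∑' k, (∑' l, a k l * v l) ^ 2 ≤ kernelSchur a ^ 2 * ∑' l, v l ^ 2 := by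
  calc ∑' k, (∑' l, a k l * v l) ^ 2
      ≤ ∑' k, (∑' l, a k l) * ∑' l, a k l * v l ^ 2 :=
        ENNReal.tsum_le_tsum fun k => ENNReal.sq_tsum_mul_le (a k) v
    _ ≤ ∑' k, kernelSchur a * ∑' l, a k l * v l ^ 2 := by
        gcongr; exact row_le_kernelSchur a _
    _ = kernelSchur a * ∑' l, (∑' k, a k l) * v l ^ 2 := by
        rw [ENNReal.tsum_mul_left, ENNReal.tsum_comm]
        simp_rw [ENNReal.tsum_mul_right]
    _ ≤ kernelSchur a * ∑' l, kernelSchur a * v l ^ 2 := by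
        gcongr; exact col_le_kernelSchur a _
    _ = _ := by rw [ENNReal.tsum_mul_left]; ring

end KernelSchur

section OperatorEntries

variable {ι : Type*} {H : Type*} [NormedAddCommGroup H]

lemma deltaSeq_self (l : ι) (f : H) : deltaSeq 2 l f l = f :=
  let := Classical.decEq ι
  Pi.single_eq_same (M := fun _ : ι => H) l f

lemma deltaSeq_of_ne {k l : ι} (h : k ≠ l) (f : H) : deltaSeq 2 l f k = 0 :=
  let := Classical.decEq ι
  Pi.single_eq_of_ne (M := fun _ : ι => H) h f

lemma norm_deltaSeq (l : ι) (f : H) : ‖(deltaSeq 2 l f : lp (fun _ : ι => H) 2)‖ = ‖f‖ := by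
  let := Classical.decEq ι
  exact lp.norm_single (E := fun _ : ι => H) (p := 2) (by simp) l f

lemma hasSum_deltaSeq (f : lp (fun _ : ι => H) 2) :
    HasSum (fun l => (deltaSeq 2 l (f l) : lp (fun _ : ι => H) 2)) f := by
  let := Classical.decEq ι
  exact lp.hasSum_single ENNReal.ofNat_ne_top f

lemma enorm_sq_eq_tsum (f : lp (fun _ : ι => H) 2) : ‖f‖ₑ ^ 2 = ∑' k, ‖f k‖ₑ ^ 2 := by
  have h := lp.hasSum_norm (p := 2) (by norm_num) f
  simp only [ENNReal.toReal_ofNat, Real.rpow_ofNat] at h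
  simp only [← ofReal_norm, ← ENNReal.ofReal_pow (norm_nonneg _)]
  rw [← ENNReal.ofReal_tsum_of_nonneg (fun _ => by positivity) h.summable, h.tsum_eq]

variable [InnerProductSpace ℂ H]

/-- The entries of the canonical matrix representation of an operator on `ℓ²(ι; H)`. -/
def opEntry (T : lp (fun _ : ι => H) 2 →L[ℂ] lp (fun _ : ι => H) 2) (k l : ι) : H →L[ℂ] H :=
  haveI := Classical.decEq ι
  (lp.evalCLM ℂ (fun _ : ι => H) 2 k).comp
    (T.comp (lp.singleContinuousLinearMap ℂ (fun _ : ι => H) 2 l))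

lemma opEntry_apply (T : lp (fun _ : ι => H) 2 →L[ℂ] lp (fun _ : ι => H) 2) (k l : ι) (f : H) :
    opEntry T k l f = T (deltaSeq 2 l f) k := rfl

lemma hasSum_opEntry (T : lp (fun _ : ι => H) 2 →L[ℂ] lp (fun _ : ι => H) 2)
    (f : lp (fun _ : ι => H) 2) (k : ι) : HasSum (fun l => opEntry T k l (f l)) (T f k) :=
  (hasSum_deltaSeq f).mapL ((lp.evalCLM ℂ (fun _ : ι => H) 2 k).comp T)

lemma hasSum_opEntry_mul (S T : lp (fun _ : ι => H) 2 →L[ℂ] lp (fun _ : ι => H) 2) (k l : ι)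
    (f : H) : HasSum (fun n => opEntry S k n (opEntry T n l f)) (opEntry (S * T) k l f) :=
  hasSum_opEntry S (T (deltaSeq 2 l f)) k

lemma norm_opEntry_le (T : lp (fun _ : ι => H) 2 →L[ℂ] lp (fun _ : ι => H) 2) (k l : ι) :
    ‖opEntry T k l‖ ≤ ‖T‖ := by
  refine ContinuousLinearMap.opNorm_le_bound _ (norm_nonneg T) fun f => ?_
  calc ‖opEntry T k l f‖ ≤ ‖T (deltaSeq 2 l f)‖ := lp.norm_apply_le_norm (by norm_num) _ k
    _ ≤ ‖T‖ * ‖f‖ := by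
      rw [← norm_deltaSeq l f]
      exact T.le_opNorm _

lemma enorm_opEntry_mul_le (S T : lp (fun _ : ι => H) 2 →L[ℂ] lp (fun _ : ι => H) 2) (k l : ι) :
    ‖opEntry (S * T) k l‖ₑ ≤ ∑' n, ‖opEntry S k n‖ₑ * ‖opEntry T n l‖ₑ := by
  refine ContinuousLinearMap.opENorm_le_bound _ fun f => ?_
  rw [← (hasSum_opEntry_mul S T k l f).tsum_eq, ← ENNReal.tsum_mul_right]
  refine enorm_tsum_le_tsum_enorm.trans (ENNReal.tsum_le_tsum fun n => ?_)
  calc ‖opEntry S k n (opEntry T n l f)‖ₑ ≤ ‖opEntry S k n‖ₑ * ‖opEntry T n l f‖ₑ :=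
        ContinuousLinearMap.le_opENorm _ _
    _ ≤ ‖opEntry S k n‖ₑ * (‖opEntry T n l‖ₑ * ‖f‖ₑ) := by gcongr; exact ContinuousLinearMap.le_opENorm _ _
    _ = _ := (mul_assoc _ _ _).symm

lemma enorm_opEntry_tsum_le {T : ℕ → (lp (fun _ : ι => H) 2 →L[ℂ] lp (fun _ : ι => H) 2)}
    (hT : Summable T) (k l : ι) :
    ‖opEntry (∑' n, T n) k l‖ₑ ≤ ∑' n, ‖opEntry (T n) k l‖ₑ := by
  refine ContinuousLinearMap.opENorm_le_bound _ fun f => ?_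
  have h : HasSum (fun n => opEntry (T n) k l f) (opEntry (∑' n, T n) k l f) :=
    hT.hasSum.mapL ((lp.evalCLM ℂ (fun _ : ι => H) 2 k).comp
      (ContinuousLinearMap.apply ℂ _ (deltaSeq 2 l f)))
  rw [← h.tsum_eq, ← ENNReal.tsum_mul_right]
  exact enorm_tsum_le_tsum_enorm.trans (ENNReal.tsum_le_tsum fun n => ContinuousLinearMap.le_opENorm _ _)

lemma opEntry_star [CompleteSpace H] (T : lp (fun _ : ι => H) 2 →L[ℂ] lp (fun _ : ι => H) 2)
    (k l : ι) : opEntry (star T) k l = star (opEntry T l k) := by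
  let := Classical.decEq ι
  refine ContinuousLinearMap.ext fun f => ext_inner_right ℂ fun g => ?_
  rw [ContinuousLinearMap.star_eq_adjoint, ContinuousLinearMap.star_eq_adjoint,
    ContinuousLinearMap.adjoint_inner_left, opEntry_apply, opEntry_apply]
  have h1 := lp.inner_single_right (𝕜 := ℂ) k g
    (ContinuousLinearMap.adjoint T (deltaSeq 2 l f) : lp (fun _ : ι => H) 2)
  have h2 := lp.inner_single_left (𝕜 := ℂ) l f (T (deltaSeq 2 k g) : lp (fun _ : ι => H) 2)
  rw [← h1, ← h2, ContinuousLinearMap.adjoint_inner_left]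
  rfl

lemma opEntry_injective {S T : lp (fun _ : ι => H) 2 →L[ℂ] lp (fun _ : ι => H) 2}
    (h : ∀ k l, opEntry S k l = opEntry T k l) : S = T := by
  ext f k
  rw [← (hasSum_opEntry S f k).tsum_eq, ← (hasSum_opEntry T f k).tsum_eq]
  simp_rw [h]

/-- The weighted Schur norm of the canonical matrix representation of an operator. -/
def opSchur (w : ι → ι → ℝ≥0∞) (T : lp (fun _ : ι => H) 2 →L[ℂ] lp (fun _ : ι => H) 2) : ℝ≥0∞ :=
  kernelSchur fun k l => ‖opEntry T k l‖ₑ * w k l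

lemma enorm_le_opSchur_one (T : lp (fun _ : ι => H) 2 →L[ℂ] lp (fun _ : ι => H) 2) :
    ‖T‖ₑ ≤ opSchur 1 T := by
  refine T.opENorm_le_bound fun f => (ENNReal.pow_le_pow_left_iff two_ne_zero).1 ?_
  rw [mul_pow, enorm_sq_eq_tsum, enorm_sq_eq_tsum]
  refine le_trans (ENNReal.tsum_le_tsum fun k => ?_) (tsum_sq_tsum_mul_le _ fun l => ‖f l‖ₑ)
  gcongr
  rw [← (hasSum_opEntry T f k).tsum_eq]
  refine enorm_tsum_le_tsum_enorm.trans (ENNReal.tsum_le_tsum fun l => ?_)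
  simpa using (opEntry T k l).le_opENorm (f l)

/-- The properties of the matrix `w k l = (1 + |k - l|) ^ δ` used below: it is a subadditive and
submultiplicative symmetric weight with balls of polynomial growth. -/
structure IsPolyWeight (w : ι → ι → ℝ≥0∞) : Prop where
  diag : ∀ k, w k k = 1
  one_le : ∀ k l, 1 ≤ w k l
  symm : ∀ k l, w k l = w l k
  le_add : ∀ k n l, w k l ≤ w k n + w n l
  le_mul : ∀ k n l, w k l ≤ w k n * w n l
  growth : ∃ D m : ℕ, ∀ (k : ι) (V : ℝ), 1 ≤ V →
    ({l | w k l ≤ ENNReal.ofReal V}.encard : ℝ≥0∞) ≤ ENNReal.ofReal (D * V ^ m)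

variable {w : ι → ι → ℝ≥0∞}

lemma opSchur_one_le (hw : ∀ k, w k k = 1) :
    opSchur w (1 : lp (fun _ : ι => H) 2 →L[ℂ] lp (fun _ : ι => H) 2) ≤ 1 := by
  classical
  have h : ∀ k l, ‖opEntry (1 : lp (fun _ : ι => H) 2 →L[ℂ] lp (fun _ : ι => H) 2) k l‖ₑ * w k l ≤
      if k = l then 1 else 0 := fun k l => by
    split_ifs with hkl
    · subst hkl
      rw [hw, mul_one]
      refine ContinuousLinearMap.opENorm_le_bound _ fun f => ?_
      simp [opEntry_apply, deltaSeq_self]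
    · have h0 : ‖opEntry (1 : lp (fun _ : ι => H) 2 →L[ℂ] lp (fun _ : ι => H) 2) k l‖ₑ ≤ 0 :=
        ContinuousLinearMap.opENorm_le_bound _ fun f => by
          simp [opEntry_apply, deltaSeq_of_ne hkl]
      rw [nonpos_iff_eq_zero.1 h0, zero_mul]
  refine (kernelSchur_mono h).trans (kernelSchur_le_iff.2 ⟨fun k => ?_, fun l => ?_⟩)
  · rw [tsum_ite_eq']
  · rw [tsum_ite_eq]

lemma opSchur_mul_le (hw : ∀ k n l, w k l ≤ w k n * w n l)
    (S T : lp (fun _ : ι => H) 2 →L[ℂ] lp (fun _ : ι => H) 2) :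
    opSchur w (S * T) ≤ opSchur w S * opSchur w T := by
  refine (kernelSchur_mono fun k l => ?_).trans (kernelSchur_mul_le _ _)
  refine (mul_le_mul_left (enorm_opEntry_mul_le S T k l) _).trans ?_
  rw [← ENNReal.tsum_mul_right]
  refine ENNReal.tsum_le_tsum fun n => ?_
  calc ‖opEntry S k n‖ₑ * ‖opEntry T n l‖ₑ * w k l
      ≤ ‖opEntry S k n‖ₑ * ‖opEntry T n l‖ₑ * (w k n * w n l) := by gcongr; exact hw _ _ _
    _ = _ := by ring

lemma opSchur_mul_le_add (hw : ∀ k n l, w k l ≤ w k n + w n l)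
    (S T : lp (fun _ : ι => H) 2 →L[ℂ] lp (fun _ : ι => H) 2) :
    opSchur w (S * T) ≤ opSchur w S * opSchur 1 T + opSchur 1 S * opSchur w T := by
  refine le_trans ?_ (add_le_add (kernelSchur_mul_le _ _) (kernelSchur_mul_le _ _))
  refine (kernelSchur_mono fun k l => ?_).trans (kernelSchur_add_le _ _)
  refine (mul_le_mul_left (enorm_opEntry_mul_le S T k l) _).trans ?_
  rw [← ENNReal.tsum_mul_right, ← ENNReal.tsum_add]
  refine ENNReal.tsum_le_tsum fun n => ?_
  calc ‖opEntry S k n‖ₑ * ‖opEntry T n l‖ₑ * w k l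
      ≤ ‖opEntry S k n‖ₑ * ‖opEntry T n l‖ₑ * (w k n + w n l) := by gcongr; exact hw _ _ _
    _ = _ := by simp only [Pi.one_apply]; ring

lemma opSchur_tsum_le {T : ℕ → (lp (fun _ : ι => H) 2 →L[ℂ] lp (fun _ : ι => H) 2)}
    (hT : Summable T) : opSchur w (∑' n, T n) ≤ ∑' n, opSchur w (T n) := by
  refine (kernelSchur_mono fun k l => ?_).trans (kernelSchur_tsum_le _)
  rw [ENNReal.tsum_mul_right]
  gcongr
  exact enorm_opEntry_tsum_le hT k l

lemma opSchur_star [CompleteSpace H] (hw : ∀ k l, w k l = w l k)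
    (T : lp (fun _ : ι => H) 2 →L[ℂ] lp (fun _ : ι => H) 2) :
    opSchur w (star T) = opSchur w T := by
  rw [opSchur, opSchur, ← kernelSchur_transpose]
  congr 1
  ext k l
  rw [opEntry_star, hw k l]
  simp [enorm_eq_nnnorm]

lemma opSchur_sub_le (S T : lp (fun _ : ι => H) 2 →L[ℂ] lp (fun _ : ι => H) 2) :
    opSchur w (S - T) ≤ opSchur w S + opSchur w T := by
  refine (kernelSchur_mono fun k l => ?_).trans (kernelSchur_add_le _ _)
  rw [← add_mul]
  gcongr
  exact enorm_sub_le

lemma opSchur_smul_le (c : ℂ) (T : lp (fun _ : ι => H) 2 →L[ℂ] lp (fun _ : ι => H) 2) :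
    opSchur w (c • T) ≤ ‖c‖ₑ * opSchur w T := by
  refine (kernelSchur_mono fun k l => ?_).trans (kernelSchur_const_mul_le _ _)
  rw [← mul_assoc, ← enorm_smul]
  rfl

lemma opSchur_one_weight_le (hw : ∀ k l, 1 ≤ w k l)
    (T : lp (fun _ : ι => H) 2 →L[ℂ] lp (fun _ : ι => H) 2) : opSchur 1 T ≤ opSchur w T :=
  kernelSchur_mono fun k l => by gcongr; exact hw k l

/-- Splitting the sum defining the unweighted Schur norm at the level `V` of the weight. -/
lemma opSchur_one_weight_le_add (hsymm : ∀ k l, w k l = w l k) {V : ℝ} (hV : 0 < V) {c : ℝ≥0∞}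
    (hc : ∀ k, ({l | w k l ≤ ENNReal.ofReal V}.encard : ℝ≥0∞) ≤ c)
    (T : lp (fun _ : ι => H) 2 →L[ℂ] lp (fun _ : ι => H) 2) :
    opSchur 1 T ≤ c * ‖T‖ₑ + (ENNReal.ofReal V)⁻¹ * opSchur w T := by
  classical
  have hV0 : ENNReal.ofReal V ≠ 0 := by simpa using hV
  have hcount : ∀ k, ∑' l, (if w k l ≤ ENNReal.ofReal V then ‖T‖ₑ else 0) ≤ c * ‖T‖ₑ := fun k => by
    calc ∑' l, (if w k l ≤ ENNReal.ofReal V then ‖T‖ₑ else 0)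
        = ∑' _l : {l | w k l ≤ ENNReal.ofReal V}, ‖T‖ₑ := by
          rw [tsum_subtype {l | w k l ≤ ENNReal.ofReal V} fun _ => ‖T‖ₑ]
          simp only [indicator_apply, mem_ofPred_eq]
      _ ≤ c * ‖T‖ₑ := by
          rw [ENNReal.tsum_set_const]
          gcongr
          exact hc k
  calc opSchur 1 T
      ≤ kernelSchur fun k l => (if w k l ≤ ENNReal.ofReal V then ‖T‖ₑ else 0) +
          (ENNReal.ofReal V)⁻¹ * (‖opEntry T k l‖ₑ * w k l) := by
        refine kernelSchur_mono fun k l => ?_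
        rw [Pi.one_apply, Pi.one_apply, mul_one]
        split_ifs with h
        · exact le_add_right (enorm_le_iff_norm_le.2 (norm_opEntry_le T k l))
        · rw [zero_add, mul_left_comm]
          refine le_mul_of_one_le_right' ?_
          rw [← ENNReal.inv_mul_cancel hV0 ENNReal.ofReal_ne_top]
          gcongr
          exact (not_le.1 h).le
    _ ≤ _ := by
        refine (kernelSchur_add_le _ _).trans (add_le_add ?_ (kernelSchur_const_mul_le _ _))
        refine kernelSchur_le_iff.2 ⟨hcount, fun l => ?_⟩
        simp_rw [fun k => hsymm k l]
        exact hcount l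

end OperatorEntries

section SpectralInvariance

variable {ι : Type*} {H : Type*} [NormedAddCommGroup H] [InnerProductSpace ℂ H]
  {w : ι → ι → ℝ≥0∞}

lemma opSchur_pow_ne_top (hw : IsPolyWeight w)
    {Q : lp (fun _ : ι => H) 2 →L[ℂ] lp (fun _ : ι => H) 2} (hQ : opSchur w Q ≠ ⊤) (n : ℕ) :
    opSchur w (Q ^ n) ≠ ⊤ := by
  induction n with
  | zero =>
    rw [pow_zero]
    exact ne_top_of_le_ne_top ENNReal.one_ne_top (opSchur_one_le hw.diag)
  | succ n ih =>
    rw [pow_succ]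
    exact ne_top_of_le_ne_top (ENNReal.mul_ne_top ih hQ) (opSchur_mul_le hw.le_mul _ _)

lemma norm_clm_pow_le {E : Type*} [NormedAddCommGroup E] [NormedSpace ℂ E] (Q : E →L[ℂ] E)
    (n : ℕ) : ‖Q ^ n‖ ≤ ‖Q‖ ^ n := by
  rcases Nat.eq_zero_or_pos n with rfl | hn
  · rw [pow_zero, pow_zero]
    exact ContinuousLinearMap.norm_id_le
  · exact norm_pow_le' Q hn

/-- The weighted Schur norms of the powers of `Q` grow no faster than the powers of its operator
norm. -/
lemma IsPolyWeight.eventually_opSchur_pow_le (hw : IsPolyWeight w)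
    {Q : lp (fun _ : ι => H) 2 →L[ℂ] lp (fun _ : ι => H) 2} (hQ : opSchur w Q ≠ ⊤)
    {σ : ℝ} (hσ : ‖Q‖ < σ) : ∀ᶠ n in atTop, (opSchur w (Q ^ n)).toReal ≤ σ ^ n := by
  obtain ⟨D, m, hD⟩ := hw.growth
  have hfin := opSchur_pow_ne_top hw hQ
  obtain ⟨s, hQs, hsσ⟩ := exists_between hσ
  have hs : 0 < s := (norm_nonneg Q).trans_lt hQs
  obtain ⟨t, ht1, hts⟩ : ∃ t : ℝ, 1 < t ∧ ‖Q‖ * t ^ m < s := by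
    have hc : Continuous fun t : ℝ => ‖Q‖ * t ^ m := by fun_prop
    have h : Tendsto (fun t : ℝ => ‖Q‖ * t ^ m) (nhdsWithin 1 (Ioi 1)) (nhds ‖Q‖) := by
      simpa using (hc.tendsto 1).mono_left nhdsWithin_le_nhds
    obtain ⟨t, h1, h2⟩ := ((h.eventually_lt_const hQs).and self_mem_nhdsWithin).exists
    exact ⟨t, h2, h1⟩
  have ht0 : 0 < t := one_pos.trans ht1
  refine eventually_le_pow_of_doubling (s := s) (τ := t⁻¹) (K := 2 * D + 2) (fun i j => ?_)
    (fun n => ENNReal.toReal_nonneg) hs hsσ (by positivity) (inv_lt_one_of_one_lt₀ ht1)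
    fun n => ?_
  · rw [pow_add, ← ENNReal.toReal_mul]
    exact ENNReal.toReal_mono (ENNReal.mul_ne_top (hfin i) (hfin j)) (opSchur_mul_le hw.le_mul _ _)
  set x := opSchur w (Q ^ n) with hx
  have hx0 : 0 ≤ x.toReal := ENNReal.toReal_nonneg
  have hb : opSchur 1 (Q ^ n) ≤ ENNReal.ofReal (D * s ^ n + t⁻¹ ^ n * x.toReal) := by
    have htn : 0 < t ^ n := pow_pos ht0 n
    refine (opSchur_one_weight_le_add hw.symm htn
      (fun k => hD k (t ^ n) (one_le_pow₀ ht1.le)) (Q ^ n)).trans ?_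
    rw [ENNReal.ofReal_add (by positivity) (by positivity),
      ENNReal.ofReal_mul (q := x.toReal) (by positivity), ENNReal.ofReal_toReal (hfin n), inv_pow,
      ENNReal.ofReal_inv_of_pos htn]
    gcongr
    rw [← ofReal_norm, ← ENNReal.ofReal_mul (by positivity)]
    refine ENNReal.ofReal_le_ofReal ?_
    calc D * (t ^ n) ^ m * ‖Q ^ n‖ ≤ D * (t ^ n) ^ m * ‖Q‖ ^ n := by
          gcongr; exact norm_clm_pow_le Q n
      _ = D * (‖Q‖ * t ^ m) ^ n := by ring
      _ ≤ D * s ^ n := by gcongr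
  have h2 : opSchur w (Q ^ (2 * n)) ≤
      ENNReal.ofReal (2 * x.toReal * (D * s ^ n + t⁻¹ ^ n * x.toReal)) := by
    rw [two_mul n, pow_add]
    refine (opSchur_mul_le_add hw.le_add _ _).trans ?_
    rw [mul_comm (opSchur 1 (Q ^ n)), ← two_mul, ENNReal.ofReal_mul (by positivity),
      ENNReal.ofReal_mul zero_le_two, ENNReal.ofReal_toReal (hfin n), ENNReal.ofReal_ofNat,
      mul_assoc]
    gcongr
  refine (ENNReal.toReal_le_of_le_ofReal (by positivity) h2).trans ?_
  have e1 : 0 ≤ s ^ n * x.toReal := by positivity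
  have e2 : 0 ≤ (D : ℝ) * (t⁻¹ ^ n * x.toReal ^ 2) := by positivity
  linarith

lemma IsPolyWeight.opSchur_geom_ne_top [CompleteSpace H] (hw : IsPolyWeight w)
    {Q : lp (fun _ : ι => H) 2 →L[ℂ] lp (fun _ : ι => H) 2} (hQ : opSchur w Q ≠ ⊤)
    (hQ1 : ‖Q‖ < 1) : opSchur w (∑' n, Q ^ n) ≠ ⊤ := by
  have hfin := opSchur_pow_ne_top hw hQ
  obtain ⟨σ, hQσ, hσ1⟩ := exists_between hQ1
  have hσ0 : 0 ≤ σ := (norm_nonneg Q).trans hQσ.le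
  have hsum : Summable fun n => (opSchur w (Q ^ n)).toReal := by
    refine Summable.of_norm_bounded_eventually_nat (summable_geometric_of_lt_one hσ0 hσ1) ?_
    filter_upwards [hw.eventually_opSchur_pow_le hQ hQσ] with n hn
    rwa [Real.norm_of_nonneg ENNReal.toReal_nonneg]
  have hQs : Summable fun n => Q ^ n := summable_geometric_of_norm_lt_one hQ1
  have h1 : ∑' n, opSchur w (Q ^ n) = ∑' n, ENNReal.ofReal (opSchur w (Q ^ n)).toReal :=
    tsum_congr fun n => (ENNReal.ofReal_toReal (hfin n)).symm
  have h2 := opSchur_tsum_le (w := w) hQs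
  rw [h1] at h2
  exact ne_top_of_le_ne_top hsum.tsum_ofReal_ne_top h2

lemma exists_norm_one_sub_smul_star_mul_self_lt_one {E : Type*} [NormedAddCommGroup E]
    [InnerProductSpace ℂ E] [CompleteSpace E] {S T : E →L[ℂ] E} (hST : S * T = 1) :
    ∃ c : ℝ, 0 < c ∧ ‖1 - (c : ℂ) • (star T * T)‖ < 1 := by
  set c : ℝ := (1 + ‖T‖ ^ 2)⁻¹ with hc
  have hc0 : 0 < c := by positivity
  have hcT : c * ‖T‖ ^ 2 ≤ 1 := by
    rw [hc, inv_mul_le_one₀ (by positivity)]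
    linarith
  set κ : ℝ := 1 - c * (1 + ‖S‖ ^ 2)⁻¹ with hκ
  have hκ1 : κ < 1 := by
    have : 0 < c * (1 + ‖S‖ ^ 2)⁻¹ := by positivity
    linarith
  have hκ0 : 0 ≤ κ := by
    have h1 : c ≤ 1 := inv_le_one_of_one_le₀ (by nlinarith [sq_nonneg ‖T‖])
    have h2 : (1 + ‖S‖ ^ 2)⁻¹ ≤ 1 := inv_le_one_of_one_le₀ (by nlinarith [sq_nonneg ‖S‖])
    have := mul_le_one₀ h1 (by positivity) h2
    linarith
  refine ⟨c, hc0, lt_of_le_of_lt (ContinuousLinearMap.opNorm_le_bound _ (Real.sqrt_nonneg κ)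
    fun x => ?_) ((Real.sqrt_lt' one_pos).2 (by simpa using hκ1))⟩
  refine abs_le_of_sq_le_sq' ?_ (by positivity) |>.2
  rw [mul_pow, Real.sq_sqrt hκ0]
  set y := ContinuousLinearMap.adjoint T (T x) with hy
  have hQ : (1 - (c : ℂ) • (star T * T)) x = x - (c : ℂ) • y := rfl
  have hinner : RCLike.re (inner ℂ x ((c : ℂ) • y)) = c * ‖T x‖ ^ 2 := by
    rw [inner_smul_right, hy, ContinuousLinearMap.adjoint_inner_right,
      inner_self_eq_norm_sq_to_K]
    norm_cast
    exact Complex.re_ofReal_mul c _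
  have hynorm : ‖y‖ ≤ ‖T‖ * ‖T x‖ := by
    have := (ContinuousLinearMap.adjoint T).le_opNorm (T x)
    rwa [LinearIsometryEquiv.norm_map] at this
  have hxnorm : ‖x‖ ≤ ‖S‖ * ‖T x‖ := by
    have : S (T x) = x := DFunLike.congr_fun hST x
    calc ‖x‖ = ‖S (T x)‖ := by rw [this]
      _ ≤ _ := S.le_opNorm _
  have hx2 : (1 + ‖S‖ ^ 2)⁻¹ * ‖x‖ ^ 2 ≤ ‖T x‖ ^ 2 := by
    rw [inv_mul_le_iff₀ (by positivity)]
    have := pow_le_pow_left₀ (norm_nonneg x) hxnorm 2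
    rw [mul_pow] at this
    nlinarith [sq_nonneg ‖T x‖]
  have hy2 : c ^ 2 * ‖y‖ ^ 2 ≤ c * ‖T x‖ ^ 2 := by
    have h1 := pow_le_pow_left₀ (norm_nonneg y) hynorm 2
    calc c ^ 2 * ‖y‖ ^ 2 ≤ c ^ 2 * (‖T‖ * ‖T x‖) ^ 2 := by gcongr
      _ = (c * ‖T‖ ^ 2) * (c * ‖T x‖ ^ 2) := by ring
      _ ≤ 1 * (c * ‖T x‖ ^ 2) := by gcongr
      _ = _ := one_mul _
  rw [hQ, norm_sub_sq (𝕜 := ℂ), hinner, norm_smul, Complex.norm_real, Real.norm_of_nonneg hc0.le,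
    mul_pow]
  have := mul_le_mul_of_nonneg_left hx2 hc0.le
  have e : κ * ‖x‖ ^ 2 = ‖x‖ ^ 2 - c * ((1 + ‖S‖ ^ 2)⁻¹ * ‖x‖ ^ 2) := by rw [hκ]; ring
  linarith

/-- Operators with finite weighted Schur norm form an inverse-closed algebra. -/
lemma IsPolyWeight.opSchur_inverse_ne_top [CompleteSpace H] (hw : IsPolyWeight w)
    {S T : lp (fun _ : ι => H) 2 →L[ℂ] lp (fun _ : ι => H) 2} (hST : S * T = 1) (hTS : T * S = 1)
    (hT : opSchur w T ≠ ⊤) : opSchur w S ≠ ⊤ := by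
  obtain ⟨c, hc0, hc⟩ := exists_norm_one_sub_smul_star_mul_self_lt_one hST
  have hT' : opSchur w (star T) ≠ ⊤ := by rwa [opSchur_star hw.symm]
  set Q := 1 - (c : ℂ) • (star T * T) with hQdef
  have hsmul : ∀ {R : lp (fun _ : ι => H) 2 →L[ℂ] lp (fun _ : ι => H) 2}, opSchur w R ≠ ⊤ →
      opSchur w ((c : ℂ) • R) ≠ ⊤ := fun hR =>
    ne_top_of_le_ne_top (ENNReal.mul_ne_top enorm_ne_top hR) (opSchur_smul_le _ _)
  have hmul : ∀ {R R' : lp (fun _ : ι => H) 2 →L[ℂ] lp (fun _ : ι => H) 2}, opSchur w R ≠ ⊤ →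
      opSchur w R' ≠ ⊤ → opSchur w (R * R') ≠ ⊤ := fun hR hR' =>
    ne_top_of_le_ne_top (ENNReal.mul_ne_top hR hR') (opSchur_mul_le hw.le_mul _ _)
  have hQ : opSchur w Q ≠ ⊤ := ne_top_of_le_ne_top (ENNReal.add_ne_top.2
    ⟨ne_top_of_le_ne_top ENNReal.one_ne_top (opSchur_one_le hw.diag), hsmul (hmul hT' hT)⟩)
    (opSchur_sub_le _ _)
  have hS : S = (∑' n, Q ^ n) * ((c : ℂ) • star T) := by
    have h1 : (∑' n, Q ^ n) * ((c : ℂ) • (star T * T)) = 1 := by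
      have := geom_series_mul_neg Q hc
      rwa [hQdef, sub_sub_cancel, ← hQdef] at this
    calc S = (∑' n, Q ^ n) * ((c : ℂ) • (star T * T)) * S := by rw [h1, one_mul]
      _ = (∑' n, Q ^ n) * ((c : ℂ) • star T) * (T * S) := by
        rw [mul_assoc, mul_assoc, smul_mul_assoc, smul_mul_assoc, mul_assoc]
      _ = _ := by rw [hTS, mul_one]
  rw [hS]
  exact hmul (hw.opSchur_geom_ne_top hQ hc) (hsmul hT')

end SpectralInvariance

section EuclideanWeights

variable {d : ℕ} {X : Set (Euc d)}

/-- The matrix of extended nonnegative numbers attached to a weight on `ℝ^d`. -/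
def weightMatrix (X : Set (Euc d)) (ν : Euc d → ℝ) : ↥X → ↥X → ℝ≥0∞ :=
  fun k l => ENNReal.ofReal (ν ((k : Euc d) - (l : Euc d)))

lemma weightMatrix_one : weightMatrix X (fun _ => (1 : ℝ)) = 1 := by
  ext k l
  simp [weightMatrix]

lemma isPolyWeight_weightMatrix (hX : RelSep X) {δ : ℝ} (hδ0 : 0 < δ) (hδ1 : δ ≤ 1) :
    IsPolyWeight (weightMatrix X fun x : Euc d => (1 + ‖x‖) ^ δ) where
  diag k := by simp [weightMatrix]
  one_le k l := by
    rw [weightMatrix, ENNReal.one_le_ofReal]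
    exact Real.one_le_rpow (by simp) hδ0.le
  symm k l := by rw [weightMatrix, weightMatrix, norm_sub_rev]
  le_add k n l := by
    rw [weightMatrix, weightMatrix, weightMatrix,
      ← ENNReal.ofReal_add (by positivity) (by positivity)]
    refine ENNReal.ofReal_le_ofReal (le_trans ?_
      (Real.rpow_add_le_add_rpow (by positivity) (by positivity) hδ0.le hδ1))
    refine Real.rpow_le_rpow (by positivity) ?_ hδ0.le
    have := norm_sub_le_norm_sub_add_norm_sub (k : Euc d) n l
    linarith
  le_mul k n l := by
    rw [weightMatrix, weightMatrix, weightMatrix, ← ENNReal.ofReal_mul (by positivity),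
      ← Real.mul_rpow (by positivity) (by positivity)]
    refine ENNReal.ofReal_le_ofReal (Real.rpow_le_rpow (by positivity) ?_ hδ0.le)
    have := norm_sub_le_norm_sub_add_norm_sub (k : Euc d) n l
    have : 0 ≤ ‖(k : Euc d) - n‖ * ‖(n : Euc d) - l‖ := by positivity
    linarith
  growth := by
    obtain ⟨D, m, h⟩ := hX.exists_encard_weight_le hδ0
    refine ⟨D, m, fun k V hV => ?_⟩
    have hV0 : 0 ≤ V := zero_le_one.trans hV
    simpa only [weightMatrix, ENNReal.ofReal_le_ofReal_iff hV0] using h k V hV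

variable {H : Type*} [NormedAddCommGroup H] [InnerProductSpace ℂ H] {ν : Euc d → ℝ}

lemma enorm_mul_weightMatrix (B : ↥X → ↥X → (H →L[ℂ] H)) (k l : ↥X) :
    ‖B k l‖ₑ * weightMatrix X ν k l =
      ENNReal.ofReal (‖B k l‖ * ν ((k : Euc d) - (l : Euc d))) := by
  rw [weightMatrix, ENNReal.ofReal_mul (norm_nonneg _), ofReal_norm]

lemma MemSchur1.kernelSchur_ne_top (hν : ∀ x, 0 ≤ ν x) {B : ↥X → ↥X → (H →L[ℂ] H)}
    (hB : MemSchur1 ν B) : kernelSchur (fun k l => ‖B k l‖ₑ * weightMatrix X ν k l) ≠ ⊤ := by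
  obtain ⟨h1, ⟨c, hc⟩, h2, ⟨c', hc'⟩⟩ := hB
  have hnn : ∀ k l : ↥X, 0 ≤ ‖B k l‖ * ν ((k : Euc d) - (l : Euc d)) := fun k l =>
    mul_nonneg (norm_nonneg _) (hν _)
  simp only [enorm_mul_weightMatrix]
  refine ne_top_of_le_ne_top (ENNReal.ofReal_ne_top (r := max c c'))
    (kernelSchur_le_iff.2 ⟨fun k => ?_, fun l => ?_⟩)
  · rw [← ENNReal.ofReal_tsum_of_nonneg (hnn k) (h1 k)]
    exact ENNReal.ofReal_le_ofReal ((hc ⟨k, rfl⟩).trans (le_max_left _ _))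
  · rw [← ENNReal.ofReal_tsum_of_nonneg (fun k => hnn k l) (h2 l)]
    exact ENNReal.ofReal_le_ofReal ((hc' ⟨l, rfl⟩).trans (le_max_right _ _))

lemma tsum_eq_toReal_tsum_ofReal {ι : Type*} {u : ι → ℝ} (hu : ∀ i, 0 ≤ u i) :
    ∑' i, u i = (∑' i, ENNReal.ofReal (u i)).toReal := by
  rw [ENNReal.tsum_toReal_eq fun _ => ENNReal.ofReal_ne_top]
  exact tsum_congr fun i => (ENNReal.toReal_ofReal (hu i)).symm

lemma summable_of_tsum_ofReal_ne_top {ι : Type*} {u : ι → ℝ} (hu : ∀ i, 0 ≤ u i)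
    (h : ∑' i, ENNReal.ofReal (u i) ≠ ⊤) : Summable u :=
  (ENNReal.summable_toReal h).congr fun i => ENNReal.toReal_ofReal (hu i)

lemma memSchur1_of_kernelSchur_ne_top (hν : ∀ x, 0 ≤ ν x) {B : ↥X → ↥X → (H →L[ℂ] H)}
    (hB : kernelSchur (fun k l => ‖B k l‖ₑ * weightMatrix X ν k l) ≠ ⊤) : MemSchur1 ν B := by
  have hnn : ∀ k l : ↥X, 0 ≤ ‖B k l‖ * ν ((k : Euc d) - (l : Euc d)) := fun k l =>
    mul_nonneg (norm_nonneg _) (hν _)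
  simp only [enorm_mul_weightMatrix] at hB
  have hr := row_le_kernelSchur fun k l : ↥X =>
    ENNReal.ofReal (‖B k l‖ * ν ((k : Euc d) - (l : Euc d)))
  have hc := col_le_kernelSchur fun k l : ↥X =>
    ENNReal.ofReal (‖B k l‖ * ν ((k : Euc d) - (l : Euc d)))
  refine ⟨fun k => summable_of_tsum_ofReal_ne_top (hnn k) (ne_top_of_le_ne_top hB (hr k)),
    ⟨(kernelSchur fun k l : ↥X =>
      ENNReal.ofReal (‖B k l‖ * ν ((k : Euc d) - (l : Euc d)))).toReal, ?_⟩,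
    fun l => summable_of_tsum_ofReal_ne_top (fun k => hnn k l)
      (ne_top_of_le_ne_top hB (hc l)),
    ⟨(kernelSchur fun k l : ↥X =>
      ENNReal.ofReal (‖B k l‖ * ν ((k : Euc d) - (l : Euc d)))).toReal, ?_⟩⟩
  · rintro _ ⟨k, rfl⟩
    simp only [tsum_eq_toReal_tsum_ofReal (hnn k)]
    exact ENNReal.toReal_mono hB (hr k)
  · rintro _ ⟨l, rfl⟩
    simp only [tsum_eq_toReal_tsum_ofReal fun k => hnn k l]
    exact ENNReal.toReal_mono hB (hc l)

lemma schurNorm1_eq_toReal_s11 (hν : ∀ x, 0 ≤ ν x) {B : ↥X → ↥X → (H →L[ℂ] H)}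
    (hB : kernelSchur (fun k l => ‖B k l‖ₑ * weightMatrix X ν k l) ≠ ⊤) :
    schurNorm1 ν B = (kernelSchur fun k l => ‖B k l‖ₑ * weightMatrix X ν k l).toReal := by
  have hnn : ∀ k l : ↥X, 0 ≤ ‖B k l‖ * ν ((k : Euc d) - (l : Euc d)) := fun k l =>
    mul_nonneg (norm_nonneg _) (hν _)
  simp only [enorm_mul_weightMatrix] at hB ⊢
  have hr := row_le_kernelSchur fun k l : ↥X =>
    ENNReal.ofReal (‖B k l‖ * ν ((k : Euc d) - (l : Euc d)))
  have hc := col_le_kernelSchur fun k l : ↥X =>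
    ENNReal.ofReal (‖B k l‖ * ν ((k : Euc d) - (l : Euc d)))
  rw [schurNorm1, kernelSchur, ENNReal.toReal_max
    (ne_top_of_le_ne_top hB (iSup_le hr)) (ne_top_of_le_ne_top hB (iSup_le hc)),
    ENNReal.toReal_iSup fun k => ne_top_of_le_ne_top hB (hr k),
    ENNReal.toReal_iSup fun l => ne_top_of_le_ne_top hB (hc l)]
  congr 1
  · exact iSup_congr fun k => tsum_eq_toReal_tsum_ofReal (hnn k)
  · exact iSup_congr fun l => tsum_eq_toReal_tsum_ofReal fun k => hnn k l

end EuclideanWeights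

section MatrixPowers

variable {ι : Type*} {H : Type*} [NormedAddCommGroup H] [InnerProductSpace ℂ H]

lemma opEntry_eq_of_apply {A : ι → ι → (H →L[ℂ] H)}
    {T : lp (fun _ : ι => H) 2 →L[ℂ] lp (fun _ : ι => H) 2}
    (hT : ∀ (f : lp (fun _ : ι => H) 2) (k : ι), T f k = ∑' l, A k l (f l)) :
    opEntry T = A := by
  ext k l f
  rw [opEntry_apply, hT, tsum_eq_single l fun n hn => by rw [deltaSeq_of_ne hn, map_zero],
    deltaSeq_self]

variable [CompleteSpace H]

lemma matMul_opEntry {S T : lp (fun _ : ι => H) 2 →L[ℂ] lp (fun _ : ι => H) 2}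
    (hS : opSchur 1 S ≠ ⊤) (hT : opSchur 1 T ≠ ⊤) :
    matMul (opEntry S) (opEntry T) = opEntry (S * T) := by
  ext k l f
  have hsum : Summable fun n => (opEntry S k n) ∘L (opEntry T n l) := by
    refine Summable.of_norm (tsum_enorm_ne_top_iff_summable_norm.1 ?_)
    refine ne_top_of_le_ne_top (ENNReal.mul_ne_top hS hT) (le_trans ?_
      ((ENNReal.le_tsum l).trans ((row_le_kernelSchur _ k).trans (kernelSchur_mul_le _ _))))
    refine ENNReal.tsum_le_tsum fun n => ?_
    simp only [Pi.one_apply, mul_one]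
    simp only [enorm_eq_nnnorm]
    exact_mod_cast ContinuousLinearMap.opNNNorm_comp_le _ _
  exact (hsum.hasSum.mapL (ContinuousLinearMap.apply ℂ H f)).unique (hasSum_opEntry_mul S T k l f)

lemma matPow_opEntry {T : lp (fun _ : ι => H) 2 →L[ℂ] lp (fun _ : ι => H) 2}
    (hT : ∀ n, opSchur 1 (T ^ n) ≠ ⊤) (n : ℕ) : matPow (opEntry T) n = opEntry (T ^ (n + 1)) := by
  induction n with
  | zero => rw [matPow, zero_add, pow_one]
  | succ n ih =>
    rw [matPow, ih, matMul_opEntry (hT _) (by simpa using hT 1), ← pow_succ]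

end MatrixPowers

lemma norm_le_norm_pow_rpow_of_isSelfAdjoint {A : Type*} [CStarAlgebra A] {a : A}
    (ha : IsSelfAdjoint a) (n : ℕ) : ‖a‖ ≤ ‖a ^ (n + 1)‖ ^ (1 / ((n : ℝ) + 1)) := by
  have h := spectrum.spectralRadius_le_pow_nnnorm_pow_one_div ℂ a n
  rw [ha.spectralRadius_eq_nnnorm] at h
  have h1 : (‖(1 : A)‖₊ : ℝ≥0∞) ^ (1 / ((n : ℝ) + 1)) ≤ 1 := by
    refine ENNReal.rpow_le_one ?_ (by positivity)
    rcases subsingleton_or_nontrivial A with hA | hA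
    · simp [Subsingleton.elim (1 : A) 0]
    · simp
  have h2 := h.trans (mul_le_of_le_one_right' h1)
  rw [← ENNReal.coe_rpow_of_nonneg _ (by positivity), ENNReal.coe_le_coe] at h2
  exact_mod_cast h2


theorem statement11 {d : ℕ} (X : Set (Euc d)) (hX : RelSep X)
    (H : Type*) [NormedAddCommGroup H] [InnerProductSpace ℂ H] [CompleteSpace H]
    [TopologicalSpace.SeparableSpace H]
    (δ : ℝ) (hδ0 : 0 < δ) (hδ1 : δ ≤ 1)
    (A : ↥X → ↥X → (H →L[ℂ] H))
    (hA : MemSchur1 (fun x : Euc d => (1 + ‖x‖) ^ δ) A)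
    (T : lp (fun _ : ↥X => H) 2 →L[ℂ] lp (fun _ : ↥X => H) 2)
    (hT : ∀ (f : lp (fun _ : ↥X => H) 2) (k : ↥X), T f k = ∑' l : ↥X, A k l (f l)) :
    ((∀ k l : ↥X, A l k = ContinuousLinearMap.adjoint (A k l)) →
      ∃ r : ℝ,
        Tendsto (fun n : ℕ =>
            (schurNorm1 (fun x : Euc d => (1 + ‖x‖) ^ δ) (matPow A n)) ^ (1 / ((n : ℝ) + 1)))
          atTop (nhds r) ∧
        Tendsto (fun n : ℕ =>
            (schurNorm1 (fun _ : Euc d => (1 : ℝ)) (matPow A n)) ^ (1 / ((n : ℝ) + 1)))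
          atTop (nhds r) ∧
        ENNReal.ofReal r = spectralRadius ℂ T ∧
        spectralRadius ℂ T = (‖T‖₊ : ℝ≥0∞)) ∧
    (∀ S : lp (fun _ : ↥X => H) 2 →L[ℂ] lp (fun _ : ↥X => H) 2,
      S.comp T = ContinuousLinearMap.id ℂ _ →
      T.comp S = ContinuousLinearMap.id ℂ _ →
      ∃ B : ↥X → ↥X → (H →L[ℂ] H),
        (∀ (k l : ↥X) (f : H), B k l f = (S (deltaSeq 2 l f)) k) ∧
        MemSchur1 (fun x : Euc d => (1 + ‖x‖) ^ δ) B) := by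
  have hν0 : ∀ x : Euc d, 0 ≤ (1 + ‖x‖) ^ δ := fun x => by positivity
  have hw := isPolyWeight_weightMatrix hX hδ0 hδ1
  have hTA : opEntry T = A := opEntry_eq_of_apply hT
  have hTfin : opSchur (weightMatrix X fun x : Euc d => (1 + ‖x‖) ^ δ) T ≠ ⊤ := by
    rw [opSchur, hTA]
    exact hA.kernelSchur_ne_top hν0
  have hpow := opSchur_pow_ne_top hw hTfin
  have hpow1 : ∀ n, opSchur 1 (T ^ n) ≠ ⊤ := fun n =>
    ne_top_of_le_ne_top (hpow n) (opSchur_one_weight_le hw.one_le _)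
  refine ⟨fun hsa => ?_, fun S hST hTS => ⟨opEntry S, fun _ _ _ => rfl,
    memSchur1_of_kernelSchur_ne_top hν0 (hw.opSchur_inverse_ne_top hST hTS hTfin)⟩⟩
  have hT' : IsSelfAdjoint T := opEntry_injective fun k l => by
    rw [opEntry_star, ContinuousLinearMap.star_eq_adjoint, hTA]
    exact (hsa l k).symm
  have hnorm : ∀ n, schurNorm1 (fun x : Euc d => (1 + ‖x‖) ^ δ) (matPow A n) =
      (opSchur (weightMatrix X fun x : Euc d => (1 + ‖x‖) ^ δ) (T ^ (n + 1))).toReal := fun n => by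
    rw [← hTA, matPow_opEntry hpow1]
    exact schurNorm1_eq_toReal_s11 hν0 (hpow (n + 1))
  have hnorm1 : ∀ n, schurNorm1 (fun _ : Euc d => (1 : ℝ)) (matPow A n) =
      (opSchur 1 (T ^ (n + 1))).toReal := fun n => by
    rw [← hTA, matPow_opEntry hpow1, ← weightMatrix_one]
    refine schurNorm1_eq_toReal_s11 (fun _ => zero_le_one) ?_
    rw [weightMatrix_one]
    exact hpow1 (n + 1)
  have hlow : ∀ n : ℕ, ‖T‖ ≤ (opSchur 1 (T ^ (n + 1))).toReal ^ (1 / ((n : ℝ) + 1)) := fun n => by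
    refine (norm_le_norm_pow_rpow_of_isSelfAdjoint hT' n).trans ?_
    gcongr
    rw [← toReal_enorm]
    exact ENNReal.toReal_mono (hpow1 _) (enorm_le_opSchur_one _)
  have hmid : ∀ n : ℕ, (opSchur 1 (T ^ (n + 1))).toReal ^ (1 / ((n : ℝ) + 1)) ≤
      (opSchur (weightMatrix X fun x : Euc d => (1 + ‖x‖) ^ δ) (T ^ (n + 1))).toReal ^
        (1 / ((n : ℝ) + 1)) := fun n => by
    gcongr
    · exact hpow _
    · exact opSchur_one_weight_le hw.one_le _
  have hlim : Tendsto (fun n : ℕ =>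
      (opSchur (weightMatrix X fun x : Euc d => (1 + ‖x‖) ^ δ) (T ^ (n + 1))).toReal ^
        (1 / ((n : ℝ) + 1))) atTop (nhds ‖T‖) := by
    refine tendsto_order.2 ⟨fun c hc => .of_forall fun n =>
      hc.trans_le ((hlow n).trans (hmid n)), fun c hc => ?_⟩
    obtain ⟨σ, hσ, hσc⟩ := exists_between hc
    have hσ0 : 0 ≤ σ := (norm_nonneg T).trans hσ.le
    have hev := (tendsto_add_atTop_nat 1).eventually (hw.eventually_opSchur_pow_le hTfin hσ)
    filter_upwards [hev] with n hn
    refine lt_of_le_of_lt ?_ hσc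
    calc _ ≤ (σ ^ (n + 1)) ^ (1 / ((n : ℝ) + 1)) := by gcongr
      _ = σ := by
        rw [one_div, ← Nat.cast_add_one]
        exact Real.pow_rpow_inv_natCast hσ0 n.succ_ne_zero
  have hrad : spectralRadius ℂ T = (‖T‖₊ : ℝ≥0∞) := hT'.spectralRadius_eq_nnnorm
  refine ⟨‖T‖, ?_, ?_, ?_, hrad⟩
  · simpa only [hnorm] using hlim
  · simp only [hnorm1]
    exact tendsto_of_tendsto_of_tendsto_of_le_of_le tendsto_const_nhds hlim hlow hmid
  · rw [hrad, ofReal_norm, enorm_eq_nnnorm]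
end
end
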